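/- arXiv:1908.04191 — 3 statements merged into one kernel-verified Lean document; each statement's English description precedes it below -/
import Mathlib

section
/- Let p ∈ ℝ[x₁,…,xₙ] be a hyperbolic polynomial with hyperbolicity cone C, let K ⊆ C be a nonempty open convex subcone, and fix a real α > 0. Then p^{−α} is completely monotone on C if and only if p^{−α} is completely monotone on K. -/
open MeasureTheory Real Set

noncomputable def iterDirDeriv {E : Type*} [NormedAddCommGroup E] [NormedSpace ℝ E] :
    ℕ → (ℕ → E) → (E → ℝ) → E → ℝ
  | 0, _, f => f
  | (k+1), v, f => fun x => fderiv ℝ (iterDirDeriv k (fun i => v (i+1)) f) x (v 0)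

/-- A function is completely monotone on `C` if it is smooth on `C` and its iterated
directional derivatives along vectors of `C` satisfy the alternating sign condition. -/
def CompletelyMonotoneOn {E : Type*} [NormedAddCommGroup E] [NormedSpace ℝ E]
    (f : E → ℝ) (C : Set E) : Prop :=
  ContDiffOn ℝ (⊤ : ℕ∞) f C ∧
  ∀ (k : ℕ) (v : ℕ → E), (∀ i, v i ∈ C) → ∀ x ∈ C, 0 ≤ (-1 : ℝ) ^ k * iterDirDeriv k v f x

/-- Evaluation of a real polynomial at a complex point. -/
noncomputable def evalC {n : ℕ} (p : MvPolynomial (Fin n) ℝ) (z : Fin n → ℂ) : ℂ :=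
  MvPolynomial.aeval z p

/-- `p` is hyperbolic with respect to `e`: `p(e) > 0` and for every `x ∈ ℝⁿ` the univariate
polynomial `t ↦ p(t·e − x)` has only real zeros. -/
def IsHyperbolicWrt {n : ℕ} (p : MvPolynomial (Fin n) ℝ) (e : Fin n → ℝ) : Prop :=
  0 < MvPolynomial.eval e p ∧
  ∀ x : Fin n → ℝ, ∀ z : ℂ,
    evalC p (fun i => z * (e i : ℂ) - (x i : ℂ)) = 0 → z.im = 0

/-- The hyperbolicity cone of `p` with respect to `e`: the connected component of
`{p ≠ 0}` containing `e`. -/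
def hypCone {n : ℕ} (p : MvPolynomial (Fin n) ℝ) (e : Fin n → ℝ) : Set (Fin n → ℝ) :=
  connectedComponentIn {x | MvPolynomial.eval x p ≠ 0} e

/-- The inclusion `ℝⁿ → ℂⁿ`. -/
noncomputable def toC (n : ℕ) : (Fin n → ℝ) →L[ℝ] (Fin n → ℂ) :=
  ContinuousLinearMap.pi fun i => Complex.ofRealCLM.comp (ContinuousLinearMap.proj i)

@[simp] lemma toC_apply {n : ℕ} (x : Fin n → ℝ) (i : Fin n) : toC n x i = (x i : ℂ) := rfl

section Garding

open Filter Topology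

variable {n : ℕ} {p : MvPolynomial (Fin n) ℝ} {d : ℕ}

lemma evalC_toC (p : MvPolynomial (Fin n) ℝ) (x : Fin n → ℝ) :
    evalC p (toC n x) = (MvPolynomial.eval x p : ℂ) := by
  have := MvPolynomial.aeval_algebraMap_apply ℂ x p
  simpa [evalC, toC, MvPolynomial.aeval_eq_eval, Function.comp_def] using this

lemma evalC_toC_ne {x : Fin n → ℝ} : evalC p (toC n x) ≠ 0 ↔ MvPolynomial.eval x p ≠ 0 := by
  rw [evalC_toC]; simp

lemma evalC_conj (p : MvPolynomial (Fin n) ℝ) (z : Fin n → ℂ) :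
    evalC p (fun i => (starRingEnd ℂ) (z i)) = (starRingEnd ℂ) (evalC p z) := by
  have h2 := MvPolynomial.comp_aeval_apply (f := z) (Complex.conjAe : ℂ →ₐ[ℝ] ℂ) p
  simpa [evalC] using h2.symm

lemma evalC_smul (hhom : p.IsHomogeneous d) (c : ℂ) (z : Fin n → ℂ) :
    evalC p (c • z) = c ^ d * evalC p z := by
  simp only [evalC, MvPolynomial.aeval_def, MvPolynomial.eval₂_eq, Finset.mul_sum]
  refine Finset.sum_congr rfl fun m hm => ?_
  have h : ∑ i ∈ m.support, m i = d := by
    have := hhom (MvPolynomial.mem_support_iff.1 hm)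
    rw [Finsupp.weight_apply] at this
    simpa [Finsupp.sum] using this
  simp only [Pi.smul_apply, smul_eq_mul, mul_pow, Finset.prod_mul_distrib, Finset.prod_pow_eq_pow_sum, h]
  ring

lemma eval_smul_real (hhom : p.IsHomogeneous d) (c : ℝ) (x : Fin n → ℝ) :
    MvPolynomial.eval (c • x) p = c ^ d * MvPolynomial.eval x p := by
  have h := evalC_smul hhom (c : ℂ) (toC n x)
  have h2 : (c : ℂ) • toC n x = toC n (c • x) := by ext i; simp
  rw [h2, evalC_toC, evalC_toC] at h
  exact_mod_cast h

lemma continuous_evalC (p : MvPolynomial (Fin n) ℝ) : Continuous (evalC p) := by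
  unfold evalC
  simp only [MvPolynomial.aeval_def, MvPolynomial.eval₂_eq]
  fun_prop

/-- The restriction of a polynomial to the complex line `t ↦ a + t b`. -/
noncomputable def linePoly (p : MvPolynomial (Fin n) ℝ) (a b : Fin n → ℂ) : Polynomial ℂ :=
  MvPolynomial.aeval (fun i => Polynomial.C (a i) + Polynomial.C (b i) * Polynomial.X) p

lemma eval_linePoly (p : MvPolynomial (Fin n) ℝ) (a b : Fin n → ℂ) (t : ℂ) :
    (linePoly p a b).eval t = evalC p (a + t • b) := by
  have := MvPolynomial.comp_aeval_apply (f := fun i => Polynomial.C (a i) + Polynomial.C (b i) * Polynomial.X)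
    ((Polynomial.aeval t : Polynomial ℂ →ₐ[ℂ] ℂ).restrictScalars ℝ) p
  rw [linePoly, evalC]
  simp only [AlgHom.restrictScalars_apply, Polynomial.coe_aeval_eq_eval] at this
  rw [this]
  congr 2
  ext i
  simp only [Polynomial.eval_add, Polynomial.eval_mul, Polynomial.eval_C, Polynomial.eval_X, Pi.add_apply, Pi.smul_apply,
    smul_eq_mul, mul_comm]

lemma natDegree_linePoly_le (hhom : p.IsHomogeneous d) (a b : Fin n → ℂ) :
    (linePoly p a b).natDegree ≤ d := by
  simp only [linePoly, MvPolynomial.aeval_def, MvPolynomial.eval₂_eq]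
  refine Polynomial.natDegree_sum_le_of_forall_le _ _ fun m hm => ?_
  have h : ∑ i ∈ m.support, m i = d := by
    have := hhom (MvPolynomial.mem_support_iff.1 hm)
    rw [Finsupp.weight_apply] at this
    simpa [Finsupp.sum] using this
  have h1 : (algebraMap ℝ (Polynomial ℂ) (MvPolynomial.coeff m p)).natDegree ≤ 0 := by
    rw [Polynomial.algebraMap_apply]; simp
  refine (Polynomial.natDegree_mul_le_of_le h1 (Polynomial.natDegree_prod_le _ _)).trans ?_
  rw [zero_add, ← h]
  refine Finset.sum_le_sum fun i _ => ?_
  refine (Polynomial.natDegree_pow_le).trans ?_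
  have : (Polynomial.C (a i) + Polynomial.C (b i) * Polynomial.X).natDegree ≤ 1 := by
    compute_degree
  nlinarith

lemma coeff_linePoly (hhom : p.IsHomogeneous d) (a b : Fin n → ℂ) :
    (linePoly p a b).coeff d = evalC p b := by
  have key : linePoly p a b = Polynomial.reflect d (linePoly p b a) := by
    refine Polynomial.eq_of_infinite_eval_eq _ _ ?_
    refine Set.Infinite.mono (s := {0}ᶜ) ?_ (Set.finite_singleton _).infinite_compl
    intro t ht
    have ht : t ≠ 0 := ht
    let _ : Invertible t⁻¹ := invertibleOfNonzero (inv_ne_zero ht)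
    have h := Polynomial.eval₂_reflect_mul_pow (RingHom.id ℂ) t⁻¹ d (linePoly p b a)
      (natDegree_linePoly_le hhom b a)
    rw [invOf_eq_inv, inv_inv] at h
    change Polynomial.eval _ _ * _ = Polynomial.eval _ _ at h
    rw [eval_linePoly] at h
    rw [mem_ofPred_eq, eval_linePoly]
    have h3 : a + t • b = t • (b + t⁻¹ • a) := by
      rw [smul_add, smul_smul, mul_inv_cancel₀ ht, one_smul, add_comm]
    rw [h3, evalC_smul hhom, ← h, inv_pow]
    field_simp
  rw [key, Polynomial.coeff_reflect, Polynomial.revAt_le le_rfl, Nat.sub_self,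
    Polynomial.coeff_zero_eq_eval_zero, eval_linePoly]
  simp

lemma evalC_root_dist_bound (hhom : p.IsHomogeneous d) (a b : Fin n → ℂ) (hb : evalC p b ≠ 0)
    (t₀ : ℂ) {ε : ℝ} (hε : 0 < ε) (h : ∀ t, evalC p (a + t • b) = 0 → ε ≤ ‖t₀ - t‖) :
    ‖evalC p b‖ * ε ^ d ≤ ‖evalC p (a + t₀ • b)‖ := by
  have hc := coeff_linePoly hhom a b
  have hdeg : (linePoly p a b).natDegree = d :=
    le_antisymm (natDegree_linePoly_le hhom a b) (Polynomial.le_natDegree_of_ne_zero (hc ▸ hb))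
  have hs := IsAlgClosed.splits (linePoly p a b)
  have hcard : (linePoly p a b).roots.card = d := by
    rw [← hdeg]; exact hs.natDegree_eq_card_roots.symm
  have hne : linePoly p a b ≠ 0 := by
    intro h0; rw [h0] at hc; simp at hc; exact hb hc.symm
  rw [← eval_linePoly]
  conv_rhs => rw [hs.eq_prod_roots]
  rw [Polynomial.leadingCoeff, hdeg, hc, Polynomial.eval_mul, Polynomial.eval_C, norm_mul,
    Polynomial.eval_multiset_prod, Multiset.map_map]
  refine mul_le_mul_of_nonneg_left ?_ (norm_nonneg _)
  have hroots : ∀ r ∈ (linePoly p a b).roots, ε ≤ ‖t₀ - r‖ := by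
    intro r hr
    apply h
    rw [← eval_linePoly]
    exact (Polynomial.mem_roots hne).1 hr
  rw [← hcard]
  generalize (linePoly p a b).roots = s at hroots
  induction s using Multiset.induction_on with
  | empty => simp
  | cons r s ih =>
    simp only [Multiset.map_cons, Multiset.prod_cons, Multiset.card_cons, norm_mul, pow_succ']
    refine mul_le_mul ?_ (ih fun r hr => hroots r (Multiset.mem_cons_of_mem hr)) (by positivity)
      (norm_nonneg _)
    simpa using hroots r (Multiset.mem_cons_self r s)

/-- Zeros of `t ↦ p(a + t b)` persist under small perturbations of `a`. -/
lemma eventually_exists_root (hhom : p.IsHomogeneous d) {a₀ b : Fin n → ℂ} (hb : evalC p b ≠ 0)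
    {t₀ : ℂ} (h0 : evalC p (a₀ + t₀ • b) = 0) {ε : ℝ} (hε : 0 < ε) :
    ∀ᶠ a in 𝓝 a₀, ∃ t, ‖t₀ - t‖ < ε ∧ evalC p (a + t • b) = 0 := by
  have hcont : Tendsto (fun a => ‖evalC p (a + t₀ • b)‖) (𝓝 a₀) (𝓝 0) := by
    have : Continuous fun a => ‖evalC p (a + t₀ • b)‖ := by
      have := continuous_evalC p
      fun_prop
    simpa [h0] using this.tendsto a₀
  have hpos : 0 < ‖evalC p b‖ * ε ^ d := by positivity
  filter_upwards [hcont.eventually_lt_const hpos] with a ha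
  by_contra! hcon
  refine absurd (evalC_root_dist_bound hhom a b hb t₀ hε fun t ht => ?_) (not_le.2 ha)
  by_contra! hlt
  exact hcon t hlt ht

lemma exists_root_bound (hhom : p.IsHomogeneous d) {b : Fin n → ℂ} (hb : evalC p b ≠ 0) :
    ∃ R : ℝ, 0 ≤ R ∧ ∀ (a : Fin n → ℂ) (t : ℂ), evalC p (a + t • b) = 0 → ‖t‖ ≤ R * ‖a‖ := by
  have : ∀ᶠ w in 𝓝 b, evalC p w ≠ 0 := (continuous_evalC p).continuousAt.eventually_ne hb
  obtain ⟨δ, hδ, h⟩ := Metric.eventually_nhds_iff_ball.1 this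
  refine ⟨δ⁻¹, by positivity, fun a t ht => ?_⟩
  by_contra! hlt
  have hnt : 0 < ‖t‖ := lt_of_le_of_lt (by positivity) hlt
  have ht0 : t ≠ 0 := norm_pos_iff.1 hnt
  refine h (b + t⁻¹ • a) ?_ ?_
  · rw [mem_ball_iff_norm, add_sub_cancel_left, norm_smul, norm_inv, inv_mul_lt_iff₀ hnt]
    rwa [inv_mul_lt_iff₀ hδ, mul_comm] at hlt
  · have h3 : a + t • b = t • (b + t⁻¹ • a) := by
      rw [smul_add, smul_smul, mul_inv_cancel₀ ht0, one_smul, add_comm]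
    rw [h3, evalC_smul hhom] at ht
    exact (mul_eq_zero.1 ht).resolve_left (pow_ne_zero _ ht0)

lemma IsHyperbolicWrt.im_eq_zero {e : Fin n → ℝ} (h : IsHyperbolicWrt p e) (x : Fin n → ℝ) {z : ℂ}
    (hz : evalC p (toC n x + z • toC n e) = 0) : z.im = 0 := by
  refine h.2 (-x) z ?_
  rw [← hz]; congr 1; ext i; simp; ring

/-- Points from which no zero of `p` is met when moving in direction `e`. -/
def rayCone (p : MvPolynomial (Fin n) ℝ) (e : Fin n → ℝ) : Set (Fin n → ℝ) :=
  {x | ∀ t : ℝ, 0 ≤ t → MvPolynomial.eval (x + t • e) p ≠ 0}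

lemma IsHyperbolicWrt.evalC_ne {e : Fin n → ℝ} (h : IsHyperbolicWrt p e) : evalC p (toC n e) ≠ 0 :=
  evalC_toC_ne.2 h.1.ne'

lemma toC_add_smul (x e : Fin n → ℝ) (t : ℝ) :
    toC n x + (t : ℂ) • toC n e = toC n (x + t • e) := by
  ext i; simp

lemma isOpen_rayCone_inter_compl (hhom : p.IsHomogeneous d) {e : Fin n → ℝ}
    (h : IsHyperbolicWrt p e) : IsOpen ({x | MvPolynomial.eval x p ≠ 0} \ rayCone p e) := by
  rw [isOpen_iff_mem_nhds]
  rintro x ⟨hx, hxr⟩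
  simp only [rayCone, mem_ofPred_eq, not_forall] at hx hxr
  obtain ⟨t, ht, h0⟩ := hxr
  push Not at h0
  have htpos : 0 < t := by
    rcases ht.eq_or_lt with rfl | h'
    · simp at h0; exact absurd h0 hx
    · exact h'
  have hroot : evalC p (toC n x + (t : ℂ) • toC n e) = 0 := by
    rw [toC_add_smul, evalC_toC, h0]; simp
  have h1 := (toC n).continuous.continuousAt.eventually
    (eventually_exists_root hhom h.evalC_ne hroot htpos)
  have h2 : ∀ᶠ y in 𝓝 x, MvPolynomial.eval y p ≠ 0 :=
    (MvPolynomial.continuous_eval p).continuousAt.eventually_ne hx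
  filter_upwards [h1, h2] with y ⟨s, hs, hs0⟩ hy
  refine ⟨hy, fun hcon => ?_⟩
  have him := h.im_eq_zero y hs0
  have hsre : s = (s.re : ℂ) := Complex.ext (by simp) (by simp [him])
  rw [hsre, toC_add_smul] at hs0
  refine evalC_toC_ne.2 (hcon s.re ?_) hs0
  have := (Complex.abs_re_le_norm (t - s)).trans_lt hs
  rw [abs_lt] at this
  simp at this
  linarith [this.2]

lemma mem_rayCone_iff (hhom : p.IsHomogeneous d) {e : Fin n → ℝ} (he : MvPolynomial.eval e p ≠ 0)
    {x : Fin n → ℝ} :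
    x ∈ rayCone p e ↔ ∀ s ∈ Icc (0 : ℝ) 1, MvPolynomial.eval ((1 - s) • x + s • e) p ≠ 0 := by
  constructor
  · rintro h s ⟨hs0, hs1⟩
    rcases hs1.eq_or_lt with rfl | hs1
    · simpa using he
    · have h1 : 0 < 1 - s := by linarith
      have : (1 - s) • x + s • e = (1 - s) • (x + (s / (1 - s)) • e) := by
        rw [smul_add, smul_smul, mul_div_cancel₀ _ h1.ne']
      rw [this, eval_smul_real hhom]
      exact mul_ne_zero (pow_ne_zero _ h1.ne') (h _ (by positivity))
  · intro h t ht
    have h1 : 0 < 1 + t := by linarith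
    have := h (t / (1 + t)) ⟨by positivity, by rw [div_le_one h1]; linarith⟩
    have h2 : (1 - t / (1 + t)) • x + (t / (1 + t)) • e = (1 + t)⁻¹ • (x + t • e) := by
      rw [smul_add, smul_smul]
      congr 2 <;> field_simp
      ring
    rw [h2, eval_smul_real hhom] at this
    exact right_ne_zero_of_mul this

lemma isOpen_rayCone (hhom : p.IsHomogeneous d) {e : Fin n → ℝ} (he : MvPolynomial.eval e p ≠ 0) :
    IsOpen (rayCone p e) := by
  rw [isOpen_iff_mem_nhds]
  intro x hx
  have hx := (mem_rayCone_iff hhom he).1 hx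
  have := isCompact_Icc (a := (0 : ℝ)) (b := 1) |>.eventually_forall_of_forall_eventually
    (x₀ := x) (P := fun x s => MvPolynomial.eval ((1 - s) • x + s • e) p ≠ 0) (fun s hs => by
      have hc : Continuous fun z : (Fin n → ℝ) × ℝ =>
          MvPolynomial.eval ((1 - z.2) • z.1 + z.2 • e) p :=
        (MvPolynomial.continuous_eval p).comp (by fun_prop)
      exact hc.continuousAt.eventually_ne (hx s hs))
  filter_upwards [this] with y hy
  exact (mem_rayCone_iff hhom he).2 hy

lemma rayCone_starConvex (hhom : p.IsHomogeneous d) {e : Fin n → ℝ}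
    (he : MvPolynomial.eval e p ≠ 0) : StarConvex ℝ e (rayCone p e) := by
  intro y hy a b ha hb hab
  rw [mem_rayCone_iff hhom he] at hy ⊢
  rintro s ⟨hs0, hs1⟩
  have := hy (1 - (1 - s) * b) ⟨by nlinarith, by nlinarith⟩
  convert this using 3
  have : a = 1 - b := by linarith
  subst this
  ext i; simp; ring

lemma self_mem_rayCone (hhom : p.IsHomogeneous d) {e : Fin n → ℝ}
    (he : MvPolynomial.eval e p ≠ 0) : e ∈ rayCone p e := by
  rw [mem_rayCone_iff hhom he]
  intro s _
  rw [← add_smul]; simpa using he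

lemma hypCone_eq_rayCone (hhom : p.IsHomogeneous d) {e : Fin n → ℝ} (h : IsHyperbolicWrt p e) :
    hypCone p e = rayCone p e := by
  have he := h.1.ne'
  have hsub : rayCone p e ⊆ {x | MvPolynomial.eval x p ≠ 0} := fun x hx => by
    simpa using hx 0 le_rfl
  apply Subset.antisymm
  · refine isPreconnected_connectedComponentIn.subset_left_of_subset_union
      (isOpen_rayCone hhom he) (isOpen_rayCone_inter_compl hhom h) disjoint_sdiff_right ?_
      ⟨e, mem_connectedComponentIn he, self_mem_rayCone hhom he⟩
    intro x hx
    rw [union_sdiff_self]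
    exact Or.inr (connectedComponentIn_subset _ _ hx)
  · exact ((rayCone_starConvex hhom he).isPathConnected
      (self_mem_rayCone hhom he)).isConnected.isPreconnected.subset_connectedComponentIn
      (self_mem_rayCone hhom he) hsub

lemma evalC_ne_of_rayCone (hhom : p.IsHomogeneous d) {e v : Fin n → ℝ} (h : IsHyperbolicWrt p e)
    (hv : v ∈ rayCone p e) (x : Fin n → ℝ) {s : ℝ} (hs : 0 < s) {t : ℂ} (ht : 0 ≤ t.im) :
    evalC p ((toC n x + (s * Complex.I) • toC n e) + t • toC n v) ≠ 0 := by
  have hvC : evalC p (toC n v) ≠ 0 := evalC_toC_ne.2 (by simpa using hv 0 le_rfl)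
  let A : ℝ → Fin n → ℂ := fun μ => toC n (μ • x) + (s * Complex.I) • toC n e
  have hA : Continuous A := by
    have := (toC n).continuous
    fun_prop
  let M : Set ℝ := {μ | ∃ t : ℂ, 0 ≤ t.im ∧ evalC p (A μ + t • toC n v) = 0}
  have hMo : IsOpen M := by
    rw [isOpen_iff_mem_nhds]
    rintro μ ⟨t, ht, h0⟩
    have htpos : 0 < t.im := by
      refine lt_of_le_of_ne ht fun h1 => ?_
      have htre : t = (t.re : ℂ) := Complex.ext (by simp) (by simp [← h1])
      have : A μ + t • toC n v = toC n (μ • x + t.re • v) + (s * Complex.I) • toC n e := by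
        rw [← toC_add_smul, ← htre]; simp only [A]; abel
      rw [this] at h0
      have := h.im_eq_zero _ h0
      simp at this
      exact hs.ne' this
    filter_upwards [hA.continuousAt.eventually (eventually_exists_root hhom hvC h0 htpos)]
      with ν ⟨t', ht', h0'⟩
    refine ⟨t', ?_, h0'⟩
    have := (Complex.abs_im_le_norm (t - t')).trans_lt ht'
    rw [abs_lt] at this
    simp at this
    linarith [this.2]
  have hMc : IsClosed M := by
    obtain ⟨R, hR, hRb⟩ := exists_root_bound hhom hvC
    refine IsSeqClosed.isClosed fun μ ν hμ hlim => ?_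
    choose t ht h0 using hμ
    obtain ⟨B, hB⟩ := ((hA.tendsto ν).comp hlim).norm.bddAbove_range
    have hbd : ∀ k, t k ∈ Metric.closedBall (0 : ℂ) (R * B) := fun k => by
      rw [mem_closedBall_zero_iff]
      exact (hRb _ _ (h0 k)).trans (mul_le_mul_of_nonneg_left (hB ⟨k, rfl⟩) hR)
    obtain ⟨τ, -, φ, hφ, hτ⟩ := (isCompact_closedBall (0 : ℂ) (R * B)).tendsto_subseq hbd
    refine ⟨τ, ge_of_tendsto' ((Complex.continuous_im.tendsto τ).comp hτ) fun k => ht (φ k), ?_⟩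
    have h1 : Tendsto (fun k => evalC p (A (μ (φ k)) + t (φ k) • toC n v)) atTop
        (𝓝 (evalC p (A ν + τ • toC n v))) :=
      ((continuous_evalC p).tendsto _).comp
        (((hA.tendsto ν).comp (hlim.comp hφ.tendsto_atTop)).add (hτ.smul_const _))
    simp only [h0] at h1
    exact tendsto_nhds_unique h1 tendsto_const_nhds
  have hM0 : (0 : ℝ) ∉ M := by
    rintro ⟨t, ht, h0⟩
    have hA0 : A 0 = (s * Complex.I) • toC n e := by simp [A]
    rw [hA0] at h0
    have hsI : (s * Complex.I : ℂ) ≠ 0 := by simp [hs.ne']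
    by_cases ht0 : t = 0
    · rw [ht0, zero_smul, add_zero, evalC_smul hhom] at h0
      exact h.evalC_ne ((mul_eq_zero.1 h0).resolve_left (pow_ne_zero _ hsI))
    · have h3 : (s * Complex.I : ℂ) • toC n e + t • toC n v
          = t • (toC n v + (s * Complex.I / t) • toC n e) := by
        rw [smul_add, smul_smul, mul_div_cancel₀ _ ht0, add_comm]
      rw [h3, evalC_smul hhom] at h0
      have h4 := (mul_eq_zero.1 h0).resolve_left (pow_ne_zero _ ht0)
      have him := h.im_eq_zero _ h4
      set r := (s * Complex.I / t : ℂ) with hr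
      have hrre : r = (r.re : ℂ) := Complex.ext (by simp) (by simp [him])
      have hrne : r.re ≠ 0 := fun h5 => by
        rw [h5] at hrre
        rw [hrre] at hr
        exact (div_ne_zero hsI ht0) (by simpa using hr.symm)
      have hrneg : r.re < 0 := by
        by_contra! hge
        rw [hrre, toC_add_smul] at h4
        exact evalC_toC_ne.2 (hv _ hge) h4
      have h6 : t * (r.re : ℂ) = s * Complex.I := by
        rw [← hrre, hr]; field_simp
      have h7 := congrArg Complex.im h6
      simp at h7
      nlinarith
  have hM : M = ∅ := (isClopen_iff.1 ⟨hMc, hMo⟩).resolve_right fun h => hM0 (h ▸ mem_univ _)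
  intro h0
  have : (1 : ℝ) ∈ M := ⟨t, ht, by simpa [A] using h0⟩
  simp [hM] at this

lemma IsHyperbolicWrt.eval_pos {e : Fin n → ℝ} (h : IsHyperbolicWrt p e) {v : Fin n → ℝ}
    (hv : v ∈ hypCone p e) : 0 < MvPolynomial.eval v p := by
  by_contra! hle
  have hpre : IsPreconnected (hypCone p e) := isPreconnected_connectedComponentIn
  obtain ⟨w, hw, hw0⟩ := hpre.intermediate_value hv (mem_connectedComponentIn h.1.ne')
    (MvPolynomial.continuous_eval p).continuousOn ⟨hle, h.1.le⟩
  exact connectedComponentIn_subset _ _ hw hw0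

lemma IsHyperbolicWrt.of_mem (hhom : p.IsHomogeneous d) {e v : Fin n → ℝ}
    (h : IsHyperbolicWrt p e) (hv : v ∈ hypCone p e) : IsHyperbolicWrt p v := by
  refine ⟨h.eval_pos hv, ?_⟩
  rw [hypCone_eq_rayCone hhom h] at hv
  have hvC : evalC p (toC n v) ≠ 0 := evalC_toC_ne.2 (by simpa using hv 0 le_rfl)
  have key : ∀ (x : Fin n → ℝ) (t : ℂ), 0 < t.im → evalC p (toC n x + t • toC n v) ≠ 0 := by
    intro x t ht h0
    have hA : Continuous fun s : ℝ => toC n x + (s * Complex.I) • toC n e := by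
      have := (toC n).continuous
      fun_prop
    have hA0 : Tendsto (fun s : ℝ => toC n x + (s * Complex.I) • toC n e) (𝓝[>] 0)
        (𝓝 (toC n x)) := by
      have := (hA.tendsto 0).mono_left (nhdsWithin_le_nhds (s := Ioi 0))
      simpa using this
    obtain ⟨s, ⟨t', ht', h0'⟩, hs⟩ :=
      ((hA0.eventually (eventually_exists_root hhom hvC h0 ht)).and self_mem_nhdsWithin).exists
    refine evalC_ne_of_rayCone hhom h hv x hs ?_ h0'
    have := (Complex.abs_im_le_norm (t - t')).trans_lt ht'
    rw [abs_lt] at this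
    simp at this
    linarith [this.2]
  intro x z hz
  have hz' : evalC p (toC n (-x) + z • toC n v) = 0 := by
    rw [← hz]; congr 1; ext i; simp; ring
  rcases lt_trichotomy z.im 0 with h1 | h1 | h1
  · refine absurd ?_ (key (-x) ((starRingEnd ℂ) z) (by simpa using h1))
    have := congrArg (starRingEnd ℂ) hz'
    rw [← evalC_conj, map_zero] at this
    rw [← this]; congr 1; ext i; simp
  · exact h1
  · exact absurd hz' (key _ _ h1)

lemma hypCone_eq_of_mem {e v : Fin n → ℝ} (hv : v ∈ hypCone p e) : hypCone p v = hypCone p e :=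
  (connectedComponentIn_eq hv).symm

lemma IsHyperbolicWrt.convex_hypCone (hhom : p.IsHomogeneous d) {e : Fin n → ℝ}
    (h : IsHyperbolicWrt p e) : Convex ℝ (hypCone p e) := by
  intro v hv
  have h' := h.of_mem hhom hv
  rw [← hypCone_eq_of_mem hv, hypCone_eq_rayCone hhom h']
  exact rayCone_starConvex hhom h'.1.ne'

lemma IsHyperbolicWrt.isOpen_hypCone (hhom : p.IsHomogeneous d) {e : Fin n → ℝ}
    (h : IsHyperbolicWrt p e) : IsOpen (hypCone p e) := by
  rw [hypCone_eq_rayCone hhom h]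
  exact isOpen_rayCone hhom h.1.ne'

lemma IsHyperbolicWrt.smul_mem_hypCone (hhom : p.IsHomogeneous d) {e : Fin n → ℝ}
    (h : IsHyperbolicWrt p e) {x : Fin n → ℝ} (hx : x ∈ hypCone p e) {t : ℝ} (ht : 0 < t) :
    t • x ∈ hypCone p e := by
  rw [hypCone_eq_rayCone hhom h] at hx ⊢
  intro s hs
  have : t • x + s • e = t • (x + (s / t) • e) := by
    rw [smul_add, smul_smul, mul_div_cancel₀ _ ht.ne']
  rw [this, eval_smul_real hhom]
  exact mul_ne_zero (pow_ne_zero _ ht.ne') (hx _ (by positivity))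

/-- A hyperbolic polynomial has no zeros in the tube over its hyperbolicity cone. -/
lemma IsHyperbolicWrt.evalC_ne_zero_of_re_mem (hhom : p.IsHomogeneous d) {e : Fin n → ℝ}
    (h : IsHyperbolicWrt p e) {z : Fin n → ℂ} (hz : (fun i => (z i).re) ∈ hypCone p e) :
    evalC p z ≠ 0 := by
  intro h0
  have h' := h.of_mem hhom hz
  have : (-Complex.I) • z = toC n (fun i => (z i).im)
      + (-Complex.I) • toC n (fun i => (z i).re) := by
    ext i
    apply Complex.ext <;> simp
  have h1 : evalC p ((-Complex.I) • z) = 0 := by rw [evalC_smul hhom, h0, mul_zero]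
  rw [this] at h1
  simpa using h'.im_eq_zero _ h1

end Garding

section Tube

open Filter Topology
open scoped ComplexOrder

variable {n : ℕ}

/-- The tube `C + iℝⁿ`. -/
def tube (C : Set (Fin n → ℝ)) : Set (Fin n → ℂ) := {z | (fun i => (z i).re) ∈ C}

lemma toC_mem_tube {C : Set (Fin n → ℝ)} {x : Fin n → ℝ} : toC n x ∈ tube C ↔ x ∈ C := by
  simp [tube]

lemma isOpen_tube {C : Set (Fin n → ℝ)} (hC : IsOpen C) : IsOpen (tube C) :=
  hC.preimage (by fun_prop)

lemma convex_tube {C : Set (Fin n → ℝ)} (hC : Convex ℝ C) : Convex ℝ (tube C) := by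
  intro z hz w hw a b ha hb hab
  have := hC hz hw ha hb hab
  convert this using 1
  simp only [tube, mem_ofPred_eq]
  congr! 1
  ext i; simp

/-- The negated directional derivative along a real vector. -/
noncomputable def negD (u : Fin n → ℝ) (H : (Fin n → ℂ) → ℂ) : (Fin n → ℂ) → ℂ :=
  fun z => -(fderiv ℂ H z (toC n u))

/-- Iterated negated directional derivatives. -/
noncomputable def negIter : ℕ → (ℕ → Fin n → ℝ) → ((Fin n → ℂ) → ℂ) → (Fin n → ℂ) → ℂ
  | 0, _, H => H
  | k + 1, v, H => negD (v 0) (negIter k (fun i => v (i + 1)) H)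

lemma AnalyticOnNhd.negD {S : Set (Fin n → ℂ)} {H : (Fin n → ℂ) → ℂ} (h : AnalyticOnNhd ℂ H S)
    (u : Fin n → ℝ) : AnalyticOnNhd ℂ (negD u H) S := by
  intro z hz
  have := ((ContinuousLinearMap.apply ℂ ℂ (toC n u)).analyticAt _).comp (h.fderiv z hz)
  exact this.neg

lemma AnalyticOnNhd.negIter {S : Set (Fin n → ℂ)} {H : (Fin n → ℂ) → ℂ}
    (h : AnalyticOnNhd ℂ H S) (k : ℕ) (v : ℕ → Fin n → ℝ) : AnalyticOnNhd ℂ (negIter k v H) S := by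
  induction k generalizing v with
  | zero => exact h
  | succ k ih => exact (ih _).negD _

lemma negD_eqOn {S : Set (Fin n → ℂ)} (hS : IsOpen S) {H G : (Fin n → ℂ) → ℂ} (h : EqOn H G S)
    (u : Fin n → ℝ) : EqOn (negD u H) (negD u G) S := fun z hz => by
  have : H =ᶠ[𝓝 z] G := h.eventuallyEq_of_mem (hS.mem_nhds hz)
  simp only [negD, this.fderiv_eq]

lemma negD_comm {H : (Fin n → ℂ) → ℂ} {z : Fin n → ℂ} (h : AnalyticAt ℂ H z) (u v : Fin n → ℝ) :
    negD u (negD v H) z = negD v (negD u H) z := by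
  have hd : DifferentiableAt ℂ (fderiv ℂ H) z := h.fderiv.differentiableAt
  have key : ∀ a b : Fin n → ℝ,
      negD a (negD b H) z = fderiv ℂ (fderiv ℂ H) z (toC n a) (toC n b) := by
    intro a b
    have h1 : HasFDerivAt (negD b H) (-((fderiv ℂ (fderiv ℂ H) z).flip (toC n b))) z := by
      have := (hd.hasFDerivAt.clm_apply (hasFDerivAt_const (toC n b) z)).neg
      simp only [ContinuousLinearMap.comp_zero, zero_add] at this
      exact this
    simp [negD, h1.fderiv]
  rw [key, key]
  exact (ContDiffAt.isSymmSndFDerivAt_of_omega h.contDiffAt) _ _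

lemma negIter_negD_eqOn {S : Set (Fin n → ℂ)} (hS : IsOpen S) {H : (Fin n → ℂ) → ℂ}
    (h : AnalyticOnNhd ℂ H S) (k : ℕ) (w : ℕ → Fin n → ℝ) (v : Fin n → ℝ) :
    EqOn (negIter k w (negD v H)) (negD v (negIter k w H)) S := by
  induction k generalizing w with
  | zero => exact fun _ _ => rfl
  | succ k ih =>
    intro z hz
    exact (negD_eqOn hS (ih _) _ hz).trans (negD_comm (h.negIter k _ z hz) _ _)

lemma negIter_negD (k : ℕ) (v : ℕ → Fin n → ℝ) (u : Fin n → ℝ) (H : (Fin n → ℂ) → ℂ) :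
    negIter k v (negD u H) = negIter (k + 1) (fun i => if i < k then v i else u) H := by
  induction k generalizing v with
  | zero => simp [negIter]
  | succ k ih =>
    rw [negIter, ih]
    conv_rhs => rw [negIter]
    simp

lemma exists_negIter_negIter {K : Set (Fin n → ℝ)} {u : Fin n → ℝ} (hu : u ∈ K) (m k : ℕ)
    {v : ℕ → Fin n → ℝ} (hv : ∀ i, v i ∈ K) (H : (Fin n → ℂ) → ℂ) :
    ∃ w : ℕ → Fin n → ℝ, (∀ i, w i ∈ K) ∧
      negIter m (fun _ => u) (negIter k v H) = negIter (m + k) w H := by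
  induction m with
  | zero => exact ⟨v, hv, by simp [negIter]⟩
  | succ m ih =>
    obtain ⟨w, hw, h⟩ := ih
    refine ⟨fun i => Nat.casesOn i u w, fun i => by cases i <;> simp [hu, hw], ?_⟩
    rw [negIter, h, Nat.add_right_comm, negIter]
    rfl

/-- An open convex cone, possibly containing the origin. -/
structure IsOpenConvexCone (C : Set (Fin n → ℝ)) : Prop where
  isOpen : IsOpen C
  convex : Convex ℝ C
  smul_mem : ∀ x ∈ C, ∀ t : ℝ, 0 < t → t • x ∈ C

lemma IsOpenConvexCone.add_smul_mem {C : Set (Fin n → ℝ)} (hC : IsOpenConvexCone C)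
    {x u : Fin n → ℝ} (hx : x ∈ C) (hu : u ∈ C) {t : ℝ} (ht : 0 ≤ t) : x + t • u ∈ C := by
  rcases ht.eq_or_lt with rfl | ht
  · simpa using hx
  have := hC.smul_mem _ (hC.convex hx (hC.smul_mem u hu t ht) (by norm_num : (0 : ℝ) ≤ 1 / 2)
    (by norm_num : (0 : ℝ) ≤ 1 / 2) (by norm_num)) 2 (by norm_num)
  convert this using 1
  module

/-- An open convex cone absorbs every vector in the directions of its elements. -/
lemma IsOpenConvexCone.exists_add_smul_mem {C : Set (Fin n → ℝ)} (hC : IsOpenConvexCone C)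
    {u : Fin n → ℝ} (hu : u ∈ C) (x : Fin n → ℝ) : ∃ t : ℝ, 0 < t ∧ x + t • u ∈ C := by
  have hcont : Continuous fun s : ℝ => s • x + u := by fun_prop
  have h0 : ∀ᶠ s : ℝ in 𝓝[>] 0, s • x + u ∈ C :=
    (hcont.continuousAt.eventually (hC.isOpen.mem_nhds (by simpa using hu))).filter_mono
      nhdsWithin_le_nhds
  obtain ⟨s, hs, hspos⟩ := (h0.and self_mem_nhdsWithin).exists
  have hspos : 0 < s := hspos
  refine ⟨s⁻¹, by positivity, ?_⟩
  have := hC.smul_mem _ hs s⁻¹ (by positivity)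
  rwa [smul_add, smul_smul, inv_mul_cancel₀ hspos.ne', one_smul] at this

lemma hasDerivAt_line {S : Set (Fin n → ℂ)} {H : (Fin n → ℂ) → ℂ} (h : AnalyticOnNhd ℂ H S)
    (u : Fin n → ℝ) {z : Fin n → ℂ} {ζ : ℂ} (hζ : z - ζ • toC n u ∈ S) :
    HasDerivAt (fun ζ : ℂ => H (z - ζ • toC n u)) (negD u H (z - ζ • toC n u)) ζ := by
  have h1 : HasDerivAt (fun ζ : ℂ => z - ζ • toC n u) (-toC n u) ζ := by
    simpa using ((hasDerivAt_id ζ).smul_const (toC n u)).const_sub z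
  have := (h _ hζ).differentiableAt.hasFDerivAt.comp_hasDerivAt ζ h1
  simpa [negD, Function.comp_def] using this

lemma iteratedDeriv_line {S : Set (Fin n → ℂ)} (hS : IsOpen S) {H : (Fin n → ℂ) → ℂ}
    (h : AnalyticOnNhd ℂ H S) (u : Fin n → ℝ) (z : Fin n → ℂ) (m : ℕ) {ζ : ℂ}
    (hζ : z - ζ • toC n u ∈ S) :
    iteratedDeriv m (fun ζ : ℂ => H (z - ζ • toC n u)) ζ
      = negIter m (fun _ => u) H (z - ζ • toC n u) := by
  induction m generalizing ζ with
  | zero => simp [negIter]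
  | succ m ih =>
    rw [iteratedDeriv_succ]
    have hc : Continuous fun ζ : ℂ => z - ζ • toC n u := by fun_prop
    have : iteratedDeriv m (fun ζ : ℂ => H (z - ζ • toC n u)) =ᶠ[𝓝 ζ]
        fun ζ => negIter m (fun _ => u) H (z - ζ • toC n u) := by
      filter_upwards [hc.continuousAt.eventually (hS.mem_nhds hζ)] with ξ hξ using ih hξ
    rw [this.deriv_eq]
    exact (hasDerivAt_line (h.negIter m _) u hζ).deriv

/-- Taylor expansion in a direction of the cone: the radius of convergence is at least the
distance to the boundary of the tube along the real direction. -/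
lemma IsOpenConvexCone.hasSum_taylor {C : Set (Fin n → ℝ)} (hC : IsOpenConvexCone C)
    {H : (Fin n → ℂ) → ℂ} (h : AnalyticOnNhd ℂ H (tube C)) {u : Fin n → ℝ} (hu : u ∈ C)
    {z : Fin n → ℂ} {s : ℂ} (hz : (fun i => (z i).re) - ‖s‖ • u ∈ C) :
    HasSum (fun m : ℕ => ((m.factorial : ℂ)⁻¹ * s ^ m) * negIter m (fun _ => u) H z)
      (H (z - s • toC n u)) := by
  have hcont : Continuous fun r : ℝ => (fun i => (z i).re) - r • u := by fun_prop
  have h0 : ∀ᶠ r : ℝ in 𝓝[>] ‖s‖, (fun i => (z i).re) - r • u ∈ C :=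
    (hcont.continuousAt.eventually (hC.isOpen.mem_nhds hz)).filter_mono nhdsWithin_le_nhds
  obtain ⟨r, hr, hsr⟩ := (h0.and self_mem_nhdsWithin).exists
  have hsr : ‖s‖ < r := hsr
  have hmem : ∀ ζ ∈ Metric.ball (0 : ℂ) r, z - ζ • toC n u ∈ tube C := by
    intro ζ hζ
    rw [mem_ball_zero_iff] at hζ
    have h1 : 0 ≤ r - ζ.re := by linarith [(Complex.re_le_norm ζ)]
    have h2 := hC.add_smul_mem hr hu h1
    simp only [tube, mem_ofPred_eq]
    convert h2 using 1
    ext i; simp; ring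
  have hd : DifferentiableOn ℂ (fun ζ : ℂ => H (z - ζ • toC n u)) (Metric.ball 0 r) :=
    fun ζ hζ => (hasDerivAt_line h u (hmem ζ hζ)).differentiableAt.differentiableWithinAt
  have hs := Complex.hasSum_taylorSeries_on_ball hd (z := s) (by simpa using hsr)
  refine hs.congr_fun fun m => ?_
  rw [iteratedDeriv_line (isOpen_tube hC.isOpen) h u z m
    (hmem 0 (Metric.mem_ball_self ((norm_nonneg s).trans_lt hsr)))]
  simp [mul_assoc]

lemma negIter_nonneg_of_subcone {C K : Set (Fin n → ℝ)} (hC : IsOpenConvexCone C)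
    (hK : IsOpenConvexCone K) (hKne : K.Nonempty) (hKC : K ⊆ C) {F : (Fin n → ℂ) → ℂ}
    (hF : AnalyticOnNhd ℂ F (tube C))
    (h : ∀ k (v : ℕ → Fin n → ℝ), (∀ i, v i ∈ K) → ∀ x ∈ K, 0 ≤ negIter k v F (toC n x))
    (k : ℕ) {v : ℕ → Fin n → ℝ} (hv : ∀ i, v i ∈ K) {x : Fin n → ℝ} (hx : x ∈ C) :
    0 ≤ negIter k v F (toC n x) := by
  obtain ⟨u, hu⟩ := hKne
  obtain ⟨t, ht, hxt⟩ := hK.exists_add_smul_mem hu x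
  have hs := hC.hasSum_taylor (hF.negIter k v) (hKC hu) (z := toC n (x + t • u)) (s := (t : ℂ))
    (by convert hx using 1; ext i; simp [abs_of_pos ht])
  have hz : toC n (x + t • u) - (t : ℂ) • toC n u = toC n x := by ext i; simp
  rw [hz] at hs
  refine hs.nonneg fun m => ?_
  obtain ⟨w, hw, he⟩ := exists_negIter_negIter hu m k hv F
  rw [he]
  refine mul_nonneg ?_ (h _ w hw _ hxt)
  have : ((m.factorial : ℂ)⁻¹ * (t : ℂ) ^ m) = (((m.factorial : ℝ)⁻¹ * t ^ m : ℝ) : ℂ) := by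
    push_cast; rfl
  rw [this, Complex.zero_le_real]
  positivity

/-- A homogeneous analytic function on the tube over `C`, of nonpositive degree, all of whose
iterated negated derivatives along `K` are nonnegative on `C`. -/
structure IsTubeMonotone (C K : Set (Fin n → ℝ)) (H : (Fin n → ℂ) → ℂ) : Prop where
  analytic : AnalyticOnNhd ℂ H (tube C)
  homog : ∃ β : ℝ, 0 ≤ β ∧ ∀ x ∈ C, ∀ t : ℝ, 0 < t →
    H (toC n (t • x)) = ((t ^ (-β) : ℝ) : ℂ) * H (toC n x)
  nonneg : ∀ k (v : ℕ → Fin n → ℝ), (∀ i, v i ∈ K) → ∀ x ∈ C, 0 ≤ negIter k v H (toC n x)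

lemma hasFDerivAt_comp_toC {H : (Fin n → ℂ) → ℂ} {x : Fin n → ℝ}
    (h : DifferentiableAt ℂ H (toC n x)) :
    HasFDerivAt (fun y => H (toC n y)) (((fderiv ℂ H (toC n x)).restrictScalars ℝ).comp (toC n)) x :=
  (h.hasFDerivAt.restrictScalars ℝ).comp x (toC n).hasFDerivAt

lemma hasFDerivAt_of_toC_eq {C : Set (Fin n → ℝ)} (hC : IsOpen C) {H : (Fin n → ℂ) → ℂ}
    {h : (Fin n → ℝ) → ℝ} (hH : ∀ y ∈ C, H (toC n y) = h y) {x : Fin n → ℝ} (hx : x ∈ C)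
    (hd : DifferentiableAt ℂ H (toC n x)) (u : Fin n → ℝ) :
    DifferentiableAt ℝ h x ∧ fderiv ℂ H (toC n x) (toC n u) = (fderiv ℝ h x u : ℂ) := by
  have h1 := hasFDerivAt_comp_toC hd
  have hre : HasFDerivAt h (Complex.reCLM.comp
      (((fderiv ℂ H (toC n x)).restrictScalars ℝ).comp (toC n))) x := by
    refine (Complex.reCLM.hasFDerivAt.comp x h1).congr_of_eventuallyEq ?_
    filter_upwards [hC.mem_nhds hx] with y hy
    simp [hH y hy]
  have him : HasFDerivAt (fun _ : Fin n → ℝ => (0 : ℝ)) (Complex.imCLM.comp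
      (((fderiv ℂ H (toC n x)).restrictScalars ℝ).comp (toC n))) x := by
    refine (Complex.imCLM.hasFDerivAt.comp x h1).congr_of_eventuallyEq ?_
    filter_upwards [hC.mem_nhds hx] with y hy
    simp [hH y hy]
  refine ⟨hre.differentiableAt, ?_⟩
  have him0 := DFunLike.congr_fun (him.unique (hasFDerivAt_const 0 x)) u
  rw [hre.fderiv]
  apply Complex.ext
  · simp
  · simpa using him0

section Properties

variable {C K : Set (Fin n → ℝ)} {H : (Fin n → ℂ) → ℂ}

lemma IsTubeMonotone.apply_nonneg (h : IsTubeMonotone C K H) (hKne : K.Nonempty) {x : Fin n → ℝ}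
    (hx : x ∈ C) : 0 ≤ H (toC n x) :=
  h.nonneg 0 (fun _ => hKne.some) (fun _ => hKne.some_mem) x hx

lemma homog_negD (hC : IsOpenConvexCone C) (ha : AnalyticOnNhd ℂ H (tube C)) {β : ℝ}
    (hh : ∀ x ∈ C, ∀ t : ℝ, 0 < t → H (toC n (t • x)) = ((t ^ (-β) : ℝ) : ℂ) * H (toC n x))
    (u : Fin n → ℝ) : ∀ x ∈ C, ∀ t : ℝ, 0 < t →
      negD u H (toC n (t • x)) = ((t ^ (-(β + 1)) : ℝ) : ℂ) * negD u H (toC n x) := by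
  intro x hx t ht
  have h1 := hasFDerivAt_comp_toC (ha _ (toC_mem_tube.2 hx)).differentiableAt
  have h2 := hasFDerivAt_comp_toC (ha _ (toC_mem_tube.2 (hC.smul_mem x hx t ht))).differentiableAt
  have h3 := h2.comp x ((hasFDerivAt_id x).const_smul t)
  have h4 := h1.const_mul (((t ^ (-β) : ℝ) : ℂ))
  have h5 := h4.congr_of_eventuallyEq (f₁ := fun y => H (toC n (t • y))) (by
    filter_upwards [hC.isOpen.mem_nhds hx] with y hy using hh y hy t ht)
  have h6 := DFunLike.congr_fun (h3.unique h5) u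
  simp at h6
  have ht' : (t : ℂ) ≠ 0 := by exact_mod_cast ht.ne'
  have h7 : ((t ^ (-(β + 1)) : ℝ) : ℂ) = ((t ^ (-β) : ℝ) : ℂ) * (t : ℂ)⁻¹ := by
    rw [neg_add, Real.rpow_add ht, Real.rpow_neg_one]; push_cast; rfl
  rw [h7]
  simp only [negD, map_smul]
  field_simp
  rw [mul_comm]
  simpa using h6

lemma IsTubeMonotone.negD_of_nonneg (hC : IsOpenConvexCone C) (h : IsTubeMonotone C K H)
    {u : Fin n → ℝ}
    (hu : ∀ k (v : ℕ → Fin n → ℝ), (∀ i, v i ∈ K) → ∀ x ∈ C, 0 ≤ negIter k v (negD u H) (toC n x)) :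
    IsTubeMonotone C K (negD u H) where
  analytic := h.analytic.negD u
  homog := by
    obtain ⟨β, hβ, hh⟩ := h.homog
    exact ⟨β + 1, by positivity, homog_negD hC h.analytic hh u⟩
  nonneg := hu

lemma IsTubeMonotone.negD_of_mem (hC : IsOpenConvexCone C) (h : IsTubeMonotone C K H)
    {u : Fin n → ℝ} (hu : u ∈ K) : IsTubeMonotone C K (negD u H) := by
  refine h.negD_of_nonneg hC fun k v hv x hx => ?_
  rw [negIter_negD]
  exact h.nonneg _ _ (fun i => by split_ifs; exacts [hv i, hu]) x hx

lemma IsTubeMonotone.negIter_of_mem (hC : IsOpenConvexCone C) (h : IsTubeMonotone C K H) (k : ℕ)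
    {v : ℕ → Fin n → ℝ} (hv : ∀ i, v i ∈ K) : IsTubeMonotone C K (negIter k v H) := by
  induction k generalizing v with
  | zero => exact h
  | succ k ih => exact (ih fun i => hv (i + 1)).negD_of_mem hC (hv 0)

lemma hasSum_taylor_re (hC : IsOpenConvexCone C) (h : AnalyticOnNhd ℂ H (tube C))
    {u : Fin n → ℝ} (hu : u ∈ C) {x : Fin n → ℝ} {r : ℝ} (hr : 0 ≤ r) (hx : x - r • u ∈ C) :
    HasSum (fun m : ℕ => ((m.factorial : ℝ)⁻¹ * r ^ m) * (negIter m (fun _ => u) H (toC n x)).re)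
      (H (toC n (x - r • u))).re := by
  have hs := hC.hasSum_taylor h hu (z := toC n x) (s := (r : ℂ)) (by
    simpa [abs_of_nonneg hr] using hx)
  have hz : toC n x - (r : ℂ) • toC n u = toC n (x - r • u) := by ext i; simp
  rw [hz] at hs
  convert Complex.hasSum_re hs using 2 with m
  have : ((m.factorial : ℂ)⁻¹ * (r : ℂ) ^ m) = (((m.factorial : ℝ)⁻¹ * r ^ m : ℝ) : ℂ) := by
    push_cast; rfl
  rw [this, Complex.re_ofReal_mul]

lemma norm_factorial_inv_mul_pow (m : ℕ) (s : ℂ) :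
    ‖(m.factorial : ℂ)⁻¹ * s ^ m‖ = (m.factorial : ℝ)⁻¹ * ‖s‖ ^ m := by
  simp

lemma IsTubeMonotone.norm_line_le (hC : IsOpenConvexCone C) (hKC : K ⊆ C)
    (h : IsTubeMonotone C K H) {u : Fin n → ℝ} (hu : u ∈ K) {x : Fin n → ℝ} {s : ℂ}
    (hx : x - ‖s‖ • u ∈ C) :
    ‖H (toC n x - s • toC n u)‖ ≤ (H (toC n (x - ‖s‖ • u))).re := by
  have h1 := hC.hasSum_taylor h.analytic (hKC hu) (z := toC n x) (s := s) (by simpa using hx)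
  have h2 := hasSum_taylor_re hC h.analytic (hKC hu) (norm_nonneg s) hx
  have hxC : x ∈ C := by simpa using hC.add_smul_mem hx (hKC hu) (norm_nonneg s)
  rw [← h1.tsum_eq]
  refine tsum_of_norm_bounded h2 fun m => ?_
  rw [norm_mul, norm_factorial_inv_mul_pow]
  gcongr
  exact (Complex.re_eq_norm.2 (h.nonneg m _ (fun _ => hu) x hxC)).ge

lemma IsTubeMonotone.norm_plane_le (hC : IsOpenConvexCone C) (hKC : K ⊆ C)
    (h : IsTubeMonotone C K H) {u w : Fin n → ℝ} (hu : u ∈ K) (hw : w ∈ K) {x : Fin n → ℝ}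
    {s s' : ℂ} (hx : x - ‖s‖ • u - ‖s'‖ • w ∈ C) :
    ‖H (toC n x - s • toC n u - s' • toC n w)‖ ≤ (H (toC n (x - ‖s‖ • u - ‖s'‖ • w))).re := by
  have hxu : x - ‖s‖ • u ∈ C := by
    simpa using hC.add_smul_mem hx (hKC hw) (norm_nonneg s')
  have h1 := hC.hasSum_taylor h.analytic (hKC hw) (z := toC n x - s • toC n u) (s := s') (by
    have h1 : 0 ≤ ‖s‖ - s.re := by linarith [Complex.re_le_norm s]
    convert hC.add_smul_mem hx (hKC hu) h1 using 1
    ext i; simp; ring)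
  have h2 := hasSum_taylor_re hC h.analytic (hKC hw) (norm_nonneg s') hx
  rw [← h1.tsum_eq]
  refine tsum_of_norm_bounded h2 fun m => ?_
  rw [norm_mul, norm_factorial_inv_mul_pow]
  gcongr
  exact (h.negIter_of_mem hC m fun _ => hw).norm_line_le hC hKC hu hxu

/-- On imaginary translates, the function is dominated by its value at the real base point. -/
lemma IsTubeMonotone.norm_imag_le (hC : IsOpenConvexCone C) (hK : IsOpenConvexCone K)
    (hKne : K.Nonempty) (hKC : K ⊆ C) (h : IsTubeMonotone C K H) {x : Fin n → ℝ} (hx : x ∈ C)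
    (v : Fin n → ℝ) (τ : ℝ) :
    ‖H (toC n x + (τ * Complex.I) • toC n v)‖ ≤ (H (toC n x)).re := by
  obtain ⟨u, hu⟩ := hKne
  obtain ⟨t, ht, ha⟩ := hK.exists_add_smul_mem hu v
  have hb := hK.smul_mem u hu t ht
  set b := t • u
  set a := v + b
  have hc : Continuous fun δ : ℝ => x - δ • (a + b) := by fun_prop
  have hc0 : Tendsto (fun δ : ℝ => x - δ • (a + b)) (𝓝[>] 0) (𝓝 x) := by
    simpa using (hc.tendsto 0).mono_left (nhdsWithin_le_nhds (s := Ioi 0))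
  have hlim : Tendsto (fun δ : ℝ => (H (toC n (x - δ • (a + b)))).re) (𝓝[>] 0)
      (𝓝 (H (toC n x)).re) :=
    (Complex.continuous_re.tendsto _).comp
      ((h.analytic _ (toC_mem_tube.2 hx)).continuousAt.tendsto.comp
        (((toC n).continuous.tendsto x).comp hc0))
  refine ge_of_tendsto hlim ?_
  filter_upwards [hc0.eventually (hC.isOpen.mem_nhds hx), self_mem_nhdsWithin] with δ hδC hδ
  have hδ : 0 < δ := hδ
  set T := (τ ^ 2 - δ ^ 2) / (2 * δ) with hT
  have hTδ : T + δ = (τ ^ 2 + δ ^ 2) / (2 * δ) := by rw [hT]; field_simp; ring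
  have hTpos : 0 ≤ T + δ := by rw [hTδ]; positivity
  have hsq : T * T + τ * τ = (T + δ) ^ 2 := by rw [hT]; field_simp; ring
  have hn1 : ‖(⟨T, -τ⟩ : ℂ)‖ = T + δ := by
    rw [Complex.norm_def, Complex.normSq_mk, neg_mul_neg, hsq, Real.sqrt_sq hTpos]
  have hn2 : ‖(⟨T, τ⟩ : ℂ)‖ = T + δ := by
    rw [Complex.norm_def, Complex.normSq_mk, hsq, Real.sqrt_sq hTpos]
  have he : (x + T • (a + b)) - (T + δ) • a - (T + δ) • b = x - δ • (a + b) := by module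
  have := h.norm_plane_le hC hKC ha hb (x := x + T • (a + b)) (s := ⟨T, -τ⟩) (s' := ⟨T, τ⟩)
    (by rw [hn1, hn2, he]; exact hδC)
  rw [hn1, hn2, he] at this
  have hz : toC n x + (τ * Complex.I) • toC n v
      = toC n (x + T • (a + b)) - (⟨T, -τ⟩ : ℂ) • toC n a - (⟨T, τ⟩ : ℂ) • toC n b := by
    ext i
    apply Complex.ext
    · simp [a]
      ring
    · simp [a]
  rwa [hz]

lemma IsTubeMonotone.exists_bound (hC : IsOpenConvexCone C) (h : IsTubeMonotone C K H)
    {x v : Fin n → ℝ} (hx : x ∈ C) (hv : v ∈ C) :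
    ∃ M : ℝ, ∀ σ : ℝ, 0 ≤ σ → ‖H (toC n (x + σ • v))‖ ≤ M := by
  obtain ⟨β, hβ, hh⟩ := h.homog
  have key : ∀ y w : Fin n → ℝ, y ∈ C → w ∈ C → ∃ M : ℝ, ∀ σ ∈ Icc (0 : ℝ) 1,
      ‖H (toC n (y + σ • w))‖ ≤ M := by
    intro y w hy hw
    refine isCompact_Icc.exists_bound_of_continuousOn fun σ hσ => ?_
    have h1 : ContinuousAt H (toC n (y + σ • w)) :=
      (h.analytic _ (toC_mem_tube.2 (hC.add_smul_mem hy hw hσ.1))).continuousAt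
    have h2 : Continuous fun σ : ℝ => toC n (y + σ • w) := by
      have := (toC n).continuous
      fun_prop
    exact (ContinuousAt.comp (f := fun σ : ℝ => toC n (y + σ • w)) h1
      h2.continuousAt).continuousWithinAt
  obtain ⟨M₁, hM₁⟩ := key x v hx hv
  obtain ⟨M₂, hM₂⟩ := key v x hv hx
  refine ⟨max M₁ M₂, fun σ hσ => ?_⟩
  rcases le_total σ 1 with h1 | h1
  · exact (hM₁ σ ⟨hσ, h1⟩).trans (le_max_left _ _)
  · have hσ : 0 < σ := by linarith
    have he : x + σ • v = σ • (v + σ⁻¹ • x) := by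
      rw [smul_add, smul_smul, mul_inv_cancel₀ hσ.ne', one_smul, add_comm]
    rw [he, hh _ (hC.add_smul_mem hv hx (by positivity)) σ hσ, norm_mul, Complex.norm_real,
      Real.norm_of_nonneg (by positivity)]
    refine le_trans ?_ ((hM₂ σ⁻¹ ⟨by positivity, inv_le_one_of_one_le₀ h1⟩).trans (le_max_right _ _))
    exact mul_le_of_le_one_left (norm_nonneg _) (Real.rpow_le_one_of_one_le_of_nonpos h1 (by linarith))

/-- Monotonicity along all directions of `C`, from the Phragmén–Lindelöf principle. -/
lemma IsTubeMonotone.negD_nonneg (hC : IsOpenConvexCone C) (hK : IsOpenConvexCone K)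
    (hKne : K.Nonempty) (hKC : K ⊆ C) (h : IsTubeMonotone C K H) {x v : Fin n → ℝ} (hx : x ∈ C)
    (hv : v ∈ C) : 0 ≤ negD v H (toC n x) := by
  obtain ⟨M, hM⟩ := h.exists_bound hC hx hv
  set g : ℂ → ℂ := fun ζ => H (toC n x + ζ • toC n v) with hg
  have hgsplit : ∀ ζ : ℂ, g ζ = H (toC n (x + ζ.re • v) + (ζ.im * Complex.I) • toC n v) := by
    intro ζ
    simp only [hg, ← toC_add_smul]
    rw [add_assoc, ← add_smul, Complex.re_add_im]
  have hgM : ∀ ζ : ℂ, 0 ≤ ζ.re → ‖g ζ‖ ≤ M := by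
    intro ζ hζ
    rw [hgsplit]
    exact (h.norm_imag_le hC hK hKne hKC (hC.add_smul_mem hx hv hζ) v ζ.im).trans
      ((Complex.re_le_norm _).trans (hM _ hζ))
  have hmax : ∀ σ : ℝ, 0 ≤ σ → ‖g σ‖ ≤ (H (toC n x)).re := by
    intro σ hσ
    refine PhragmenLindelof.right_half_plane_of_bounded_on_real (f := g) ?_ ⟨1, by norm_num, 0, ?_⟩
      ?_ ?_ (by simpa using hσ)
    · refine DifferentiableOn.diffContOnCl fun ζ hζ => ?_
      rw [Complex.closure_setOfPred_lt_re] at hζ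
      have hmem : toC n x + ζ • toC n v ∈ tube C := by
        have := hC.add_smul_mem hx hv (t := ζ.re) hζ
        simp only [tube, mem_ofPred_eq]
        convert this using 1
        ext i; simp
      exact ((h.analytic _ hmem).differentiableAt.comp ζ (by fun_prop)).differentiableWithinAt
    · refine Asymptotics.IsBigO.of_bound M ?_
      rw [eventually_inf_principal]
      refine Eventually.of_forall fun ζ hζ => ?_
      simpa using hgM ζ (le_of_lt hζ)
    · refine ⟨M, ?_⟩
      rw [eventually_map]
      filter_upwards [eventually_ge_atTop 0] with σ hσ
      exact hgM σ (by simpa using hσ)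
    · intro τ
      exact h.norm_imag_le hC hK hKne hKC hx v τ
  have hreal : ∀ y ∈ C, H (toC n y) = ((H (toC n y)).re : ℂ) := fun y hy => by
    have := Complex.nonneg_iff.1 (h.apply_nonneg hKne hy)
    exact Complex.ext (by simp) (by simp [← this.2])
  obtain ⟨hd, he⟩ := hasFDerivAt_of_toC_eq hC.isOpen (h := fun y => (H (toC n y)).re) hreal hx
    (h.analytic _ (toC_mem_tube.2 hx)).differentiableAt v
  have hline : HasDerivAt (fun σ : ℝ => (H (toC n (x + σ • v))).re)
      (fderiv ℝ (fun y => (H (toC n y)).re) x v) 0 := by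
    have h1 : HasDerivAt (fun σ : ℝ => x + σ • v) v 0 := by
      simpa using ((hasDerivAt_id (0 : ℝ)).smul_const v).const_add x
    have h2 : HasFDerivAt (fun y => (H (toC n y)).re) (fderiv ℝ (fun y => (H (toC n y)).re) x)
        (x + (0 : ℝ) • v) := by simpa using hd.hasFDerivAt
    exact h2.comp_hasDerivAt 0 h1
  have hnonpos : fderiv ℝ (fun y => (H (toC n y)).re) x v ≤ 0 := by
    have ht := (hasDerivAt_iff_tendsto_slope_zero.1 hline).mono_left
      (nhdsWithin_mono 0 (fun y (hy : 0 < y) => hy.ne') : 𝓝[>] (0 : ℝ) ≤ 𝓝[≠] 0)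
    refine le_of_tendsto ht ?_
    filter_upwards [self_mem_nhdsWithin] with σ hσ
    have hσ : 0 < σ := hσ
    have h3 := (Complex.re_le_norm _).trans (hmax σ hσ.le)
    rw [hg] at h3
    simp only [toC_add_smul] at h3
    simp only [zero_add, zero_smul, add_zero, smul_eq_mul]
    exact mul_nonpos_of_nonneg_of_nonpos (by positivity) (by linarith)
  simp only [negD, he, ← Complex.ofReal_neg, Complex.zero_le_real]
  linarith

lemma IsTubeMonotone.negD_of_mem_cone (hC : IsOpenConvexCone C) (hK : IsOpenConvexCone K)
    (hKne : K.Nonempty) (hKC : K ⊆ C) (h : IsTubeMonotone C K H) {v : Fin n → ℝ} (hv : v ∈ C) :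
    IsTubeMonotone C K (negD v H) := by
  refine h.negD_of_nonneg hC fun k w hw x hx => ?_
  rw [negIter_negD_eqOn (isOpen_tube hC.isOpen) h.analytic k w v (toC_mem_tube.2 hx)]
  exact (h.negIter_of_mem hC k hw).negD_nonneg hC hK hKne hKC hx hv

lemma IsTubeMonotone.negIter_of_mem_cone (hC : IsOpenConvexCone C) (hK : IsOpenConvexCone K)
    (hKne : K.Nonempty) (hKC : K ⊆ C) (h : IsTubeMonotone C K H) (k : ℕ) {v : ℕ → Fin n → ℝ}
    (hv : ∀ i, v i ∈ C) : IsTubeMonotone C K (negIter k v H) := by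
  induction k generalizing v with
  | zero => exact h
  | succ k ih => exact (ih fun i => hv (i + 1)).negD_of_mem_cone hC hK hKne hKC (hv 0)

lemma negIter_toC_eq (hC : IsOpen C) (ha : AnalyticOnNhd ℂ H (tube C)) {f : (Fin n → ℝ) → ℝ}
    (hf : ∀ x ∈ C, H (toC n x) = f x) (k : ℕ) (v : ℕ → Fin n → ℝ) :
    ∀ x ∈ C, negIter k v H (toC n x) = (((-1 : ℝ) ^ k * iterDirDeriv k v f x : ℝ) : ℂ) := by
  induction k generalizing v with
  | zero => intro x hx; simpa [negIter, iterDirDeriv] using hf x hx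
  | succ k ih =>
    intro x hx
    obtain ⟨hd, he⟩ := hasFDerivAt_of_toC_eq hC (ih fun i => v (i + 1)) hx
      (ha.negIter k _ _ (toC_mem_tube.2 hx)).differentiableAt (v 0)
    have hd' : DifferentiableAt ℝ (iterDirDeriv k (fun i => v (i + 1)) f) x := by
      simpa [← mul_assoc, ← mul_pow] using hd.const_mul ((-1 : ℝ) ^ k)
    rw [negIter, negD, he, iterDirDeriv, fderiv_const_mul hd', pow_succ]
    simp

end Properties

end Tube

section Power

open Filter Topology
open scoped ComplexOrder

variable {n : ℕ}

lemma analyticAt_of_exp_eq {S : Set (Fin n → ℂ)} (hS : IsOpen S) {G P : (Fin n → ℂ) → ℂ}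
    (hG : ContinuousOn G S) (hP : AnalyticOnNhd ℂ P S) (h : ∀ z ∈ S, Complex.exp (G z) = P z) :
    AnalyticOnNhd ℂ G S := by
  intro w hw
  have hc : ContinuousAt G w := hG.continuousAt (hS.mem_nhds hw)
  have hPw : P w ≠ 0 := h w hw ▸ Complex.exp_ne_zero _
  have him : ∀ᶠ z in 𝓝 w, |(G z - G w).im| < 1 := by
    have : Tendsto (fun z => |(G z - G w).im|) (𝓝 w) (𝓝 |(G w - G w).im|) :=
      ((Complex.continuous_im.tendsto _).comp (hc.tendsto.sub_const _)).abs
    exact this.eventually (gt_mem_nhds (by simp))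
  have hlog : AnalyticAt ℂ (fun z => G w + Complex.log (P z / P w)) w := by
    refine analyticAt_const.add (((hP w hw).div_const).clog ?_)
    simp [div_self hPw]
  refine hlog.congr ?_
  filter_upwards [him, hS.mem_nhds hw] with z hz hzS
  rw [abs_lt] at hz
  rw [← h z hzS, ← h w hw, ← Complex.exp_sub, Complex.log_exp]
  · ring
  · linarith [hz.1, Real.pi_gt_three]
  · linarith [hz.2, Real.pi_gt_three]

/-- A continuous logarithm of a positive function on a preconnected set, real at one point, is
real everywhere. -/
lemma im_eq_zero_of_exp_pos {X : Type*} [TopologicalSpace X] {S : Set X} (hS : IsPreconnected S)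
    {G : X → ℂ} (hG : ContinuousOn G S) {q : X → ℝ} (hq : ∀ x ∈ S, 0 < q x)
    (h : ∀ x ∈ S, Complex.exp (G x) = q x) {a : X} (ha : a ∈ S) (hGa : (G a).im = 0) {x : X}
    (hx : x ∈ S) : (G x).im = 0 := by
  have hcos : ∀ y ∈ S, 0 < Real.cos (G y).im ∧ Real.sin (G y).im = 0 := by
    intro y hy
    have h1 := congrArg Complex.re (h y hy)
    have h2 := congrArg Complex.im (h y hy)
    rw [Complex.exp_re, Complex.ofReal_re] at h1
    rw [Complex.exp_im, Complex.ofReal_im] at h2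
    constructor
    · exact (pos_iff_pos_of_mul_pos (h1 ▸ hq y hy)).1 (Real.exp_pos _)
    · exact (mul_eq_zero.1 h2).resolve_left (Real.exp_pos _).ne'
  have hc : ContinuousOn (fun y => |(G y).im|) S :=
    (Complex.continuous_im.comp_continuousOn hG).abs
  have hlt : |(G x).im| < π := by
    by_contra! hle
    obtain ⟨y, hy, hyπ⟩ := hS.intermediate_value ha hx hc ⟨by simp [hGa, Real.pi_pos.le], hle⟩
    have := (hcos y hy).1
    rw [← Real.cos_abs, show |(G y).im| = π from hyπ, Real.cos_pi] at this
    linarith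
  rw [abs_lt] at hlt
  exact (Real.sin_eq_zero_iff_of_lt_of_lt hlt.1 hlt.2).1 (hcos x hx).2

lemma analyticOnNhd_evalC (p : MvPolynomial (Fin n) ℝ) (S : Set (Fin n → ℂ)) :
    AnalyticOnNhd ℂ (evalC p) S := fun z _ =>
  AnalyticAt.aeval_mvPolynomial (f := fun z : Fin n → ℂ => z)
    (fun i => (ContinuousLinearMap.proj (R := ℂ) (φ := fun _ : Fin n => ℂ) i).analyticAt z) p

/-- A real power of a hyperbolic polynomial extends analytically to the tube over its
hyperbolicity cone. -/
lemma IsHyperbolicWrt.exists_analytic_rpow {p : MvPolynomial (Fin n) ℝ} {d : ℕ}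
    (hhom : p.IsHomogeneous d) {e : Fin n → ℝ} (h : IsHyperbolicWrt p e) (s : ℝ) :
    ∃ F : (Fin n → ℂ) → ℂ, AnalyticOnNhd ℂ F (tube (hypCone p e)) ∧
      ∀ x ∈ hypCone p e, F (toC n x) = (MvPolynomial.eval x p ^ s : ℝ) := by
  have he : e ∈ hypCone p e := mem_connectedComponentIn h.1.ne'
  have hconv := h.convex_hypCone hhom
  have hopen := isOpen_tube (h.isOpen_hypCone hhom)
  have hsc : IsSimplyConnected (tube (hypCone p e)) := by
    have := (convex_tube hconv).contractibleSpace ⟨toC n e, toC_mem_tube.2 he⟩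
    exact (inferInstance : SimplyConnectedSpace (tube (hypCone p e)))
  obtain ⟨L, hLc, hL⟩ := Complex.exists_continuousOn_eqOn_exp_comp hsc hopen
    (continuous_evalC p).continuousOn (by
      rintro ⟨z, hz, h0⟩
      exact h.evalC_ne_zero_of_re_mem hhom hz h0)
  have hL' : ∀ z ∈ tube (hypCone p e), Complex.exp (L z) = evalC p z := fun z hz => hL hz
  set c : ℂ := Real.log (MvPolynomial.eval e p) - L (toC n e) with hc
  have hexpc : Complex.exp c = 1 := by
    rw [hc, Complex.exp_sub, hL' _ (toC_mem_tube.2 he), evalC_toC, ← Complex.ofReal_exp,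
      Real.exp_log h.1, div_self (by exact_mod_cast h.1.ne')]
  have hG : ∀ z ∈ tube (hypCone p e), Complex.exp (L z + c) = evalC p z := fun z hz => by
    rw [Complex.exp_add, hexpc, mul_one, hL' z hz]
  have hGc : ContinuousOn (fun z => L z + c) (tube (hypCone p e)) := hLc.add continuousOn_const
  have hGa := analyticAt_of_exp_eq hopen hGc (analyticOnNhd_evalC p _) hG
  refine ⟨fun z => Complex.exp (s * (L z + c)),
    fun z hz => (analyticAt_const.mul (hGa z hz)).cexp, fun x hx => ?_⟩
  have hGx : ∀ y ∈ hypCone p e, Complex.exp (L (toC n y) + c) = MvPolynomial.eval y p :=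
    fun y hy => by rw [hG _ (toC_mem_tube.2 hy), evalC_toC]
  have him : (L (toC n x) + c).im = 0 :=
    im_eq_zero_of_exp_pos hconv.isPreconnected
      (hGc.comp (toC n).continuous.continuousOn fun y hy => toC_mem_tube.2 hy)
      (fun y hy => h.eval_pos hy) hGx he (by simp [hc]) hx
  have hre : L (toC n x) + c = ((L (toC n x) + c).re : ℂ) := Complex.ext (by simp) (by simpa using him)
  have hexp : Real.exp (L (toC n x) + c).re = MvPolynomial.eval x p := by
    have := hGx x hx
    rw [hre] at this
    exact_mod_cast this
  rw [Real.rpow_def_of_pos (h.eval_pos hx), ← hexp, Real.log_exp]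
  beta_reduce
  rw [Complex.ofReal_exp, Complex.ofReal_mul, ← hre, mul_comm]

lemma contDiffOn_eval_rpow {p : MvPolynomial (Fin n) ℝ} {S : Set (Fin n → ℝ)}
    (hS : ∀ x ∈ S, MvPolynomial.eval x p ≠ 0) (s : ℝ) :
    ContDiffOn ℝ (⊤ : ℕ∞) (fun x => MvPolynomial.eval x p ^ s) S := by
  have h1 : ContDiff ℝ (⊤ : ℕ∞) fun x : Fin n → ℝ => MvPolynomial.eval x p := by
    rw [contDiff_iff_contDiffAt]
    intro x
    exact ((AnalyticOnNhd.eval_mvPolynomial p) x (mem_univ x)).contDiffAt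
  exact h1.contDiffOn.rpow_const_of_ne hS

lemma eval_rpow_smul {p : MvPolynomial (Fin n) ℝ} {d : ℕ} (hhom : p.IsHomogeneous d) (s : ℝ)
    {x : Fin n → ℝ} (hx : 0 ≤ MvPolynomial.eval x p) {t : ℝ} (ht : 0 ≤ t) :
    MvPolynomial.eval (t • x) p ^ s = t ^ (d * s) * MvPolynomial.eval x p ^ s := by
  rw [eval_smul_real hhom, Real.mul_rpow (pow_nonneg ht d) hx, Real.rpow_mul ht, Real.rpow_natCast]

end Power

/-- Let `p` be a hyperbolic polynomial with hyperbolicity cone `C`, let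
`K ⊆ C` be a nonempty open convex subcone, and `α > 0`.  Then `p^{−α}` is completely monotone
on `C` if and only if it is completely monotone on `K`. -/
theorem statement13 (n : ℕ) (p : MvPolynomial (Fin n) ℝ) (d : ℕ) (hhom : p.IsHomogeneous d)
    (e : Fin n → ℝ) (hhyp : IsHyperbolicWrt p e)
    (K : Set (Fin n → ℝ)) (hKsub : K ⊆ hypCone p e) (hKne : K.Nonempty)
    (hKopen : IsOpen K) (hKconv : Convex ℝ K)
    (hKcone : ∀ x ∈ K, ∀ t : ℝ, 0 < t → t • x ∈ K)
    (α : ℝ) (hα : 0 < α) :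
    CompletelyMonotoneOn (fun x => MvPolynomial.eval x p ^ (-α)) (hypCone p e) ↔
    CompletelyMonotoneOn (fun x => MvPolynomial.eval x p ^ (-α)) K := by
  refine ⟨fun h => ⟨h.1.mono hKsub, fun k v hv x hx =>
    h.2 k v (fun i => hKsub (hv i)) x (hKsub hx)⟩, fun h => ⟨?_, ?_⟩⟩
  · exact contDiffOn_eval_rpow (fun x hx => (hhyp.eval_pos hx).ne') _
  have hC : IsOpenConvexCone (hypCone p e) :=
    ⟨hhyp.isOpen_hypCone hhom, hhyp.convex_hypCone hhom,
      fun x hx t ht => hhyp.smul_mem_hypCone hhom hx ht⟩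
  have hK : IsOpenConvexCone K := ⟨hKopen, hKconv, hKcone⟩
  obtain ⟨F, hFa, hF⟩ := hhyp.exists_analytic_rpow hhom (-α)
  have hiter := negIter_toC_eq hC.isOpen hFa hF
  have hmono : IsTubeMonotone (hypCone p e) K F :=
    { analytic := hFa
      homog := by
        refine ⟨d * α, by positivity, fun x hx t ht => ?_⟩
        rw [hF _ (hC.smul_mem x hx t ht), hF x hx,
          eval_rpow_smul hhom _ (hhyp.eval_pos hx).le ht.le, mul_neg]
        push_cast
        rfl
      nonneg := fun k v hv x hx => by
        refine negIter_nonneg_of_subcone hC hK hKne hKsub hFa (fun k v hv x hx => ?_) k hv hx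
        rw [hiter k v x (hKsub hx)]
        exact_mod_cast h.2 k v hv x hx }
  intro k v hv x hx
  have := (hmono.negIter_of_mem_cone hC hK hKne hKsub k hv).apply_nonneg hKne hx
  rw [hiter k v x hx] at this
  exact_mod_cast this
end

section
/- Fix α > 0, an open convex cone C ⊆ ℝⁿ, and C^∞ functions A, B : C → ℝ_{>0}. Then the function (x, y) ↦ (A(x) + B(x)·y)^{−α} is completely monotone on the cone C × ℝ_{>0} ⊆ ℝⁿ⁺¹ if and only if, for every t ≥ 0, the function x ↦ B(x)^{−α} e^{−t·A(x)/B(x)} is completely monotone on C. -/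
open MeasureTheory Real Set

/-- The iterated difference `∏ (1 - T_h)` over `h ∈ l`, applied to `f`,
where `T_h f x = f (x + h)`. -/
def iterDiff {E : Type*} [AddCommGroup E] : List E → (E → ℝ) → E → ℝ
  | [], f => f
  | h :: l, f => fun x => iterDiff l f x - iterDiff l f (x + h)

/-- The finite-difference form of complete monotonicity on `C`, with increments in `D`. -/
def DiffCompletelyMonotone {E : Type*} [AddCommGroup E] (f : E → ℝ) (D C : Set E) : Prop :=
  ∀ l : List E, (∀ h ∈ l, h ∈ D) → ∀ x ∈ C, 0 ≤ iterDiff l f x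

section IterDiff

variable {E : Type*} [AddCommGroup E] {D C : Set E} {f g : E → ℝ}

theorem iterDiff_sub_translate (l : List E) (f : E → ℝ) (h x : E) (c : ℝ) :
    iterDiff l (fun y => f y - c * f (y + h)) x = iterDiff l f x - c * iterDiff l f (x + h) := by
  induction l generalizing x with
  | nil => rfl
  | cons a l ih =>
    simp only [iterDiff, ih]
    rw [add_right_comm x a h]
    ring

theorem iterDiff_cons_eq (l : List E) (f : E → ℝ) (h x : E) :
    iterDiff (h :: l) f x = iterDiff l (fun y => f y - f (y + h)) x := by
  simpa [iterDiff] using (iterDiff_sub_translate l f h x 1).symm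

theorem iterDiff_const_mul (l : List E) (f : E → ℝ) (c : ℝ) (x : E) :
    iterDiff l (fun y => c * f y) x = c * iterDiff l f x := by
  induction l generalizing x with
  | nil => rfl
  | cons a l ih => simp only [iterDiff, ih]; ring

theorem iterDiff_comp_add {F : Type*} [AddCommGroup F] (φ : F → E) (ψ : F → E)
    (hφ : ∀ x h, φ (x + h) = φ x + ψ h) (l : List F) (f : E → ℝ) (x : F) :
    iterDiff l (fun y => f (φ y)) x = iterDiff (l.map ψ) f (φ x) := by
  induction l generalizing x with
  | nil => rfl
  | cons a l ih => simp only [iterDiff, List.map_cons, ih, hφ]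

theorem tendsto_iterDiff {ι : Type*} {p : Filter ι} {u : ι → E → ℝ}
    (hD : ∀ x ∈ C, ∀ h ∈ D, x + h ∈ C)
    (hu : ∀ x ∈ C, Filter.Tendsto (fun i => u i x) p (nhds (f x)))
    (l : List E) (hl : ∀ h ∈ l, h ∈ D) (x : E) (hx : x ∈ C) :
    Filter.Tendsto (fun i => iterDiff l (u i) x) p (nhds (iterDiff l f x)) := by
  induction l generalizing x with
  | nil => exact hu x hx
  | cons a l ih =>
    simp only [List.mem_cons, forall_eq_or_imp] at hl
    exact (ih hl.2 x hx).sub (ih hl.2 (x + a) (hD x hx a hl.1))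

theorem DiffCompletelyMonotone.of_tendsto {ι : Type*} {p : Filter ι} [p.NeBot] {u : ι → E → ℝ}
    (hD : ∀ x ∈ C, ∀ h ∈ D, x + h ∈ C)
    (hu : ∀ x ∈ C, Filter.Tendsto (fun i => u i x) p (nhds (f x)))
    (hcm : ∀ᶠ i in p, DiffCompletelyMonotone (u i) D C) : DiffCompletelyMonotone f D C :=
  fun l hl x hx => ge_of_tendsto (tendsto_iterDiff hD hu l hl x hx)
    (hcm.mono fun _ hi => hi l hl x hx)

theorem DiffCompletelyMonotone.congr (hD : ∀ x ∈ C, ∀ h ∈ D, x + h ∈ C)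
    (hf : DiffCompletelyMonotone f D C) (hfg : EqOn f g C) : DiffCompletelyMonotone g D C :=
  .of_tendsto (p := (Filter.atTop : Filter ℕ)) (u := fun _ => f) hD
    (fun x hx => by rw [hfg hx]; exact tendsto_const_nhds) (.of_forall fun _ => hf)

theorem DiffCompletelyMonotone.const_mul (hf : DiffCompletelyMonotone f D C) {c : ℝ}
    (hc : 0 ≤ c) : DiffCompletelyMonotone (fun x => c * f x) D C := fun l hl x hx => by
  rw [iterDiff_const_mul]
  exact mul_nonneg hc (hf l hl x hx)

theorem DiffCompletelyMonotone.sub_translate (hf : DiffCompletelyMonotone f D C) {h : E}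
    (hh : h ∈ D) : DiffCompletelyMonotone (fun x => f x - f (x + h)) D C := fun l hl x hx => by
  rw [← iterDiff_cons_eq]
  exact hf (h :: l) (by simpa using ⟨hh, hl⟩) x hx

theorem DiffCompletelyMonotone.sub_mul_translate (hD : ∀ x ∈ C, ∀ h ∈ D, x + h ∈ C)
    (hf : DiffCompletelyMonotone f D C) {h : E} (hh : h ∈ D) {c : ℝ} (hc : c ≤ 1) :
    DiffCompletelyMonotone (fun x => f x - c * f (x + h)) D C := fun l hl x hx => by
  rw [iterDiff_sub_translate]
  have h₁ := hf (h :: l) (by simpa using ⟨hh, hl⟩) x hx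
  have h₂ := hf l hl (x + h) (hD x hx h hh)
  simp only [iterDiff] at h₁
  nlinarith

theorem DiffCompletelyMonotone.integral {T : Type*} [MeasurableSpace T] {μ : Measure T}
    {φ : T → E → ℝ} (hD : ∀ x ∈ C, ∀ h ∈ D, x + h ∈ C)
    (hInt : ∀ x ∈ C, Integrable (fun t => φ t x) μ)
    (hcm : ∀ᵐ t ∂μ, DiffCompletelyMonotone (φ t) D C) :
    DiffCompletelyMonotone (fun x => ∫ t, φ t x ∂μ) D C := by
  have key : ∀ l : List E, (∀ h ∈ l, h ∈ D) → ∀ x ∈ C,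
      Integrable (fun t => iterDiff l (φ t) x) μ ∧
        iterDiff l (fun x => ∫ t, φ t x ∂μ) x = ∫ t, iterDiff l (φ t) x ∂μ := by
    intro l hl
    induction l with
    | nil => exact fun x hx => ⟨hInt x hx, rfl⟩
    | cons a l ih =>
      intro x hx
      simp only [List.mem_cons, forall_eq_or_imp] at hl
      obtain ⟨i₁, e₁⟩ := ih hl.2 x hx
      obtain ⟨i₂, e₂⟩ := ih hl.2 (x + a) (hD x hx a hl.1)
      refine ⟨i₁.sub i₂, ?_⟩
      simp only [iterDiff]
      rw [e₁, e₂, integral_sub i₁ i₂]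
  intro l hl x hx
  rw [(key l hl x hx).2]
  exact integral_nonneg_of_ae (hcm.mono fun t ht => ht l hl x hx)

theorem DiffCompletelyMonotone.exp_mul {t : ℝ} (ht : 0 ≤ t)
    (hC : ∀ x ∈ C, ∀ h ∈ C, x + h ∈ C) (hf : DiffCompletelyMonotone f C C) :
    DiffCompletelyMonotone (fun q : E × ℝ => Real.exp (-(t * q.2)) * f q.1)
      (C ×ˢ Set.Ioi (0 : ℝ)) (C ×ˢ Set.Ioi (0 : ℝ)) := by
  intro l
  induction l generalizing f with
  | nil => exact fun _ q hq => mul_nonneg (exp_nonneg _) (hf [] (by simp) q.1 hq.1)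
  | cons a l ih =>
    intro hl q hq
    simp only [List.mem_cons, forall_eq_or_imp] at hl
    have ha : 0 < a.2 := hl.1.2
    have hc : Real.exp (-(t * a.2)) ≤ 1 := Real.exp_le_one_iff.2 (by nlinarith)
    have := ih (hf.sub_mul_translate hC hl.1.1 hc) hl.2 q hq
    rw [iterDiff_cons_eq]
    convert this using 2
    funext y
    simp only [Prod.fst_add, Prod.snd_add, mul_add, neg_add, Real.exp_add]
    ring

end IterDiff

section Normed

variable {E : Type*} [NormedAddCommGroup E] [NormedSpace ℝ E] {D C : Set E} {f g : E → ℝ}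

theorem DiffCompletelyMonotone.of_hasLineDerivAt (hD : ∀ x ∈ C, ∀ h ∈ D, x + h ∈ C)
    (hf : DiffCompletelyMonotone f D C) {v : E} (hv : ∀ s : ℝ, 0 < s → s • v ∈ D)
    (hfg : ∀ x ∈ C, HasLineDerivAt ℝ f (-g x) x v) : DiffCompletelyMonotone g D C := by
  refine .of_tendsto (p := nhdsWithin (0 : ℝ) (Ioi 0))
    (u := fun s x => s⁻¹ * (f x - f (x + s • v))) hD (fun x hx => ?_) ?_
  · have := (hfg x hx).tendsto_slope_zero_right.neg
    simp only [neg_neg] at this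
    refine this.congr fun s => ?_
    rw [smul_eq_mul]
    ring
  · filter_upwards [self_mem_nhdsWithin] with s hs
    exact (hf.sub_translate (hv s hs)).const_mul (inv_nonneg.2 (le_of_lt hs))

theorem DiffCompletelyMonotone.extend_increments
    (hC : ∀ x ∈ C, ∀ t : ℝ, 0 < t → t • x ∈ C)
    (hD : ∀ x ∈ C, ∀ h ∈ D, x + h ∈ C) (hCC : ∀ x ∈ C, ∀ h ∈ C, x + h ∈ C)
    (hcont : ContinuousOn f C) (hopen : IsOpen C) (hf : DiffCompletelyMonotone f C C) :
    DiffCompletelyMonotone f D C := by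
  intro l hl x hx
  induction l generalizing f with
  | nil => exact hf [] (by simp) x hx
  | cons h l ih =>
    simp only [List.mem_cons, forall_eq_or_imp] at hl
    rw [iterDiff_cons_eq]
    refine ih (hcont.sub (hcont.comp (by fun_prop) fun y hy => hD y hy h hl.1)) ?_ hl.2
    refine .of_tendsto (p := nhdsWithin (0 : ℝ) (Ioi 0))
      (u := fun s y => f y - f (y + (s • x + h))) hCC (fun y hy => ?_) ?_
    · refine tendsto_const_nhds.sub ?_
      have h₁ := (hcont.continuousAt (hopen.mem_nhds (hD y hy h hl.1))).tendsto
      refine h₁.comp ?_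
      have h₂ : Continuous fun s : ℝ => y + (s • x + h) := by fun_prop
      have h₃ := h₂.tendsto 0
      simp only [zero_smul, zero_add] at h₃
      exact h₃.mono_left nhdsWithin_le_nhds
    · filter_upwards [self_mem_nhdsWithin] with s hs
      exact hf.sub_translate (hD _ (hC x hx s hs) h hl.1)

theorem hasLineDerivAt_iterDiff (hD : ∀ x ∈ C, ∀ h ∈ D, x + h ∈ C) {v : E}
    (hfg : ∀ x ∈ C, HasLineDerivAt ℝ f (g x) x v) (l : List E) (hl : ∀ h ∈ l, h ∈ D)
    (x : E) (hx : x ∈ C) : HasLineDerivAt ℝ (iterDiff l f) (iterDiff l g x) x v := by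
  induction l generalizing x with
  | nil => exact hfg x hx
  | cons a l ih =>
    simp only [List.mem_cons, forall_eq_or_imp] at hl
    have h₁ : HasDerivAt _ _ _ := ih hl.2 x hx
    have h₂ : HasDerivAt _ _ _ := ih hl.2 (x + a) (hD x hx a hl.1)
    have h₃ := h₁.sub h₂
    refine HasDerivAt.congr_of_eventuallyEq h₃ (.of_forall fun s => ?_)
    simp only [iterDiff, Pi.sub_apply, add_right_comm x a]

theorem le_of_hasLineDerivAt_nonpos {x h : E} {f f' : E → ℝ}
    (hf : ∀ s : ℝ, 0 ≤ s → HasLineDerivAt ℝ f (f' (x + s • h)) (x + s • h) h)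
    (hf' : ∀ s : ℝ, 0 ≤ s → f' (x + s • h) ≤ 0) : f (x + h) ≤ f x := by
  have hd : ∀ s : ℝ, 0 ≤ s → HasDerivAt (fun s : ℝ => f (x + s • h)) (f' (x + s • h)) s := by
    intro s hs
    have h₀ : HasDerivAt _ _ _ := hf s hs
    rw [← sub_self s] at h₀
    have h₁ := h₀.comp_sub_const s s
    refine h₁.congr_of_eventuallyEq (.of_forall fun r => ?_)
    simp only [add_assoc, ← add_smul, add_sub_cancel]
  have anti : AntitoneOn (fun s : ℝ => f (x + s • h)) (Ici 0) := by
    refine antitoneOn_of_deriv_nonpos (convex_Ici 0)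
      (fun s hs => (hd s hs).continuousAt.continuousWithinAt)
      (fun s hs => (hd s (interior_subset hs)).differentiableAt.differentiableWithinAt)
      fun s hs => ?_
    rw [(hd s (interior_subset hs)).deriv]
    exact hf' s (interior_subset hs)
  simpa using anti (show (0 : ℝ) ∈ Ici 0 by simp) (show (1 : ℝ) ∈ Ici 0 by simp) zero_le_one

theorem contDiffOn_iterDirDeriv (hopen : IsOpen C) (hf : ContDiffOn ℝ (⊤ : ℕ∞) f C)
    (k : ℕ) (v : ℕ → E) : ContDiffOn ℝ (⊤ : ℕ∞) (iterDirDeriv k v f) C := by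
  induction k generalizing v with
  | zero => exact hf
  | succ k ih =>
    exact ((ih fun i => v (i + 1)).fderiv_of_isOpen hopen (by simp)).clm_apply contDiffOn_const

theorem hasLineDerivAt_iterDirDeriv (hopen : IsOpen C) (hf : ContDiffOn ℝ (⊤ : ℕ∞) f C)
    (k : ℕ) (v : ℕ → E) (x : E) (hx : x ∈ C) :
    HasLineDerivAt ℝ (fun y => (-1 : ℝ) ^ k * iterDirDeriv k (fun i => v (i + 1)) f y)
      (-((-1 : ℝ) ^ (k + 1) * iterDirDeriv (k + 1) v f x)) x (v 0) := by
  have hd := ((contDiffOn_iterDirDeriv hopen hf k fun i => v (i + 1)).differentiableOn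
    (by simp)).differentiableAt (hopen.mem_nhds hx)
  have h₁ : HasDerivAt _ _ _ := hd.hasFDerivAt.hasLineDerivAt (v 0)
  have h₂ := h₁.const_mul ((-1 : ℝ) ^ k)
  refine h₂.congr_deriv ?_
  simp only [iterDirDeriv, pow_succ]
  ring

theorem completelyMonotoneOn_iff_diff (hopen : IsOpen C)
    (hadd : ∀ x ∈ C, ∀ h ∈ C, x + h ∈ C) (hcone : ∀ x ∈ C, ∀ t : ℝ, 0 < t → t • x ∈ C)
    (hf : ContDiffOn ℝ (⊤ : ℕ∞) f C) :
    CompletelyMonotoneOn f C ↔ DiffCompletelyMonotone f C C := by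
  constructor
  · rintro ⟨-, hcm⟩
    have key : ∀ l : List E, (∀ h ∈ l, h ∈ C) → ∀ (k : ℕ) (v : ℕ → E), (∀ i, v i ∈ C) →
        ∀ x ∈ C, 0 ≤ iterDiff l (fun y => (-1 : ℝ) ^ k * iterDirDeriv k v f y) x := by
      intro l hl
      induction l with
      | nil => exact hcm
      | cons h l ih =>
        intro k v hv x hx
        simp only [List.mem_cons, forall_eq_or_imp] at hl
        let w : ℕ → E := fun i => Nat.casesOn i h v
        have hw : ∀ i, w i ∈ C := by
          rintro (_ | i)
          · exact hl.1
          · exact hv i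
        have hseg : ∀ s : ℝ, 0 ≤ s → x + s • h ∈ C := by
          intro s hs
          rcases hs.eq_or_lt with rfl | hs
          · simpa using hx
          · exact hadd x hx _ (hcone h hl.1 s hs)
        simp only [iterDiff, sub_nonneg]
        refine le_of_hasLineDerivAt_nonpos
          (fun s hs => hasLineDerivAt_iterDiff hadd
            (fun y hy => hasLineDerivAt_iterDirDeriv hopen hf k w y hy) l hl.2 _ (hseg s hs))
          fun s hs => ?_
        have h₁ := ih hl.2 (k + 1) w hw _ (hseg s hs)
        have h₂ := iterDiff_const_mul l
          (fun y => (-1 : ℝ) ^ (k + 1) * iterDirDeriv (k + 1) w f y) (-1) (x + s • h)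
        simp only [neg_one_mul] at h₂
        rw [h₂]
        linarith
    intro l hl x hx
    have := key l hl 0 (fun _ => x) (fun _ => hx) x hx
    simpa [iterDirDeriv] using this
  · intro hcm
    have key : ∀ (k : ℕ) (v : ℕ → E), (∀ i, v i ∈ C) →
        DiffCompletelyMonotone (fun x => (-1 : ℝ) ^ k * iterDirDeriv k v f x) C C := by
      intro k
      induction k with
      | zero => intro v _; simpa [iterDirDeriv] using hcm
      | succ k ih =>
        intro v hv
        exact (ih (fun i => v (i + 1)) fun i => hv (i + 1)).of_hasLineDerivAt hadd
          (hcone _ (hv 0)) (hasLineDerivAt_iterDirDeriv hopen hf k v)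
    exact ⟨hf, fun k v hv x hx => key k v hv [] (by simp) x hx⟩

end Normed

section Kernel

variable {α a b t : ℝ}

theorem integrableOn_rpow_mul_exp_neg_mul (hα : 0 < α) (hb : 0 < b) :
    IntegrableOn (fun t : ℝ => t ^ (α - 1) * Real.exp (-(b * t))) (Ioi 0) := by
  have := integrableOn_rpow_mul_exp_neg_mul_rpow (p := 1) (s := α - 1) (b := b)
    (by linarith) one_pos hb
  simpa using this

theorem exp_mul_kernel_eq (a y : ℝ) (hb : b ≠ 0) :
    t ^ (α - 1) * (Real.exp (-(t * y)) * (b ^ (-α) * Real.exp (-t * a / b))) =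
      b ^ (-α) * (t ^ (α - 1) * Real.exp (-((a / b + y) * t))) := by
  have : Real.exp (-((a / b + y) * t)) = Real.exp (-(t * y)) * Real.exp (-t * a / b) := by
    rw [← Real.exp_add]
    congr 1
    field_simp
    ring
  rw [this]
  ring

theorem rpow_neg_eq_integral {y : ℝ} (hα : 0 < α) (ha : 0 < a) (hb : 0 < b) (hy : 0 < y) :
    (Real.Gamma α)⁻¹ * ∫ t in Ioi (0 : ℝ), t ^ (α - 1) *
      (Real.exp (-(t * y)) * (b ^ (-α) * Real.exp (-t * a / b))) = (a + b * y) ^ (-α) := by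
  have hr : 0 < a / b + y := by positivity
  simp only [exp_mul_kernel_eq a y hb.ne']
  rw [integral_const_mul, Real.integral_rpow_mul_exp_neg_mul_Ioi hα hr, one_div,
    Real.inv_rpow hr.le, ← Real.rpow_neg hr.le, ← mul_assoc (b ^ (-α)),
    ← Real.mul_rpow hb.le hr.le, mul_comm, mul_assoc,
    mul_inv_cancel₀ (Real.Gamma_pos_of_pos hα).ne', mul_one]
  congr 1
  field_simp

theorem tendsto_kernel (ha : 0 < a) (hb : 0 < b) (ht : 0 < t) :
    Filter.Tendsto (fun k : ℕ => ((k : ℝ) / t) ^ (α + k) *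
      (b ^ k * (a + b * (k / t)) ^ (-(α + k)))) Filter.atTop
      (nhds (b ^ (-α) * Real.exp (-t * a / b))) := by
  have h₁ := Real.tendsto_one_add_div_pow_exp (t * a / b)
  have h₀ : Filter.Tendsto (fun k : ℕ => 1 + t * a / b / (k : ℝ)) Filter.atTop (nhds 1) := by
    simpa using (tendsto_const_div_atTop_nhds_zero_nat (t * a / b)).const_add 1
  have h₂ := h₀.rpow_const (p := -α) (Or.inl one_ne_zero)
  have h₃ := (h₂.mul (h₁.inv₀ (Real.exp_pos _).ne')).const_mul (b ^ (-α))
  rw [Real.one_rpow, one_mul, ← Real.exp_neg, ← neg_div, ← neg_mul] at h₃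
  refine h₃.congr' ?_
  filter_upwards [Filter.eventually_gt_atTop 0] with k hk
  have hk' : (0 : ℝ) < k := Nat.cast_pos.2 hk
  have hy : 0 < (k : ℝ) / t := by positivity
  have hs : 0 < 1 + t * a / b / (k : ℝ) := by positivity
  have e : a + b * (k / t) = b * (k / t) * (1 + t * a / b / k) := by field_simp; ring
  rw [e, Real.mul_rpow (by positivity) hs.le, Real.mul_rpow hb.le hy.le, neg_add,
    Real.rpow_add hs, Real.rpow_add hb, Real.rpow_add hy, Real.rpow_add hy,
    Real.rpow_neg hs.le k, Real.rpow_neg hb.le k, Real.rpow_neg hy.le k, Real.rpow_neg hy.le α]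
  simp only [Real.rpow_natCast]
  have := Real.rpow_pos_of_pos hy α
  field_simp

theorem hasDerivAt_kernel {y : ℝ} (k : ℕ) (h : 0 < a + b * y) :
    HasDerivAt (fun s => b ^ k * (a + b * s) ^ (-(α + k)))
      (-((α + k) * (b ^ (k + 1) * (a + b * y) ^ (-(α + (k + 1 : ℕ)))))) y := by
  have h₁ : HasDerivAt (fun s => a + b * s) b y := by
    simpa using ((hasDerivAt_id y).const_mul b).const_add a
  refine ((h₁.rpow_const (p := -(α + k)) (Or.inl h.ne')).const_mul (b ^ k)).congr_deriv ?_
  rw [show -(α + k) - 1 = -(α + (k + 1 : ℕ)) by push_cast; ring]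
  ring

end Kernel

theorem diffCompletelyMonotone_rpow_of_exp {E : Type*} [AddCommGroup E] {C : Set E}
    {A B : E → ℝ} {α : ℝ} (hα : 0 < α) (hadd : ∀ x ∈ C, ∀ h ∈ C, x + h ∈ C)
    (hApos : ∀ x ∈ C, 0 < A x) (hBpos : ∀ x ∈ C, 0 < B x)
    (hcm : ∀ t : ℝ, 0 ≤ t →
      DiffCompletelyMonotone (fun x => B x ^ (-α) * Real.exp (-t * A x / B x)) C C) :
    DiffCompletelyMonotone (fun q : E × ℝ => (A q.1 + B q.1 * q.2) ^ (-α))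
      (C ×ˢ Set.Ioi (0 : ℝ)) (C ×ˢ Set.Ioi (0 : ℝ)) := by
  have hP : ∀ q ∈ C ×ˢ Set.Ioi (0 : ℝ), ∀ h ∈ C ×ˢ Set.Ioi (0 : ℝ), q + h ∈ C ×ˢ Set.Ioi (0 : ℝ) :=
    fun q hq h hh => ⟨hadd _ hq.1 _ hh.1, add_pos (show 0 < q.2 from hq.2) hh.2⟩
  have hInt : DiffCompletelyMonotone (fun q : E × ℝ => ∫ t in Ioi (0 : ℝ), t ^ (α - 1) *
      (Real.exp (-(t * q.2)) * (B q.1 ^ (-α) * Real.exp (-t * A q.1 / B q.1))))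
      (C ×ˢ Set.Ioi (0 : ℝ)) (C ×ˢ Set.Ioi (0 : ℝ)) := by
    refine .integral hP (fun q hq => ?_) ?_
    · have hB := hBpos _ hq.1
      have hA := hApos _ hq.1
      have hy : 0 < q.2 := hq.2
      simp only [exp_mul_kernel_eq _ _ hB.ne']
      exact (integrableOn_rpow_mul_exp_neg_mul hα (by positivity)).const_mul _
    · filter_upwards [ae_restrict_mem measurableSet_Ioi] with t ht
      have ht' : 0 ≤ t := le_of_lt ht
      exact ((hcm t ht').exp_mul ht' hadd).const_mul (Real.rpow_nonneg ht' _)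
  refine (hInt.const_mul (inv_nonneg.2 (Real.Gamma_pos_of_pos hα).le)).congr hP fun q hq => ?_
  exact rpow_neg_eq_integral hα (hApos _ hq.1) (hBpos _ hq.1) hq.2

theorem diffCompletelyMonotone_exp_of_rpow {E : Type*} [NormedAddCommGroup E] [NormedSpace ℝ E]
    {C : Set E} {A B : E → ℝ} {α : ℝ} (hα : 0 < α) (hopen : IsOpen C)
    (hadd : ∀ x ∈ C, ∀ h ∈ C, x + h ∈ C) (hcone : ∀ x ∈ C, ∀ t : ℝ, 0 < t → t • x ∈ C)
    (hApos : ∀ x ∈ C, 0 < A x) (hBpos : ∀ x ∈ C, 0 < B x)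
    (hcont : ContinuousOn (fun q : E × ℝ => (A q.1 + B q.1 * q.2) ^ (-α)) (C ×ˢ Set.Ioi (0 : ℝ)))
    (hcm : DiffCompletelyMonotone (fun q : E × ℝ => (A q.1 + B q.1 * q.2) ^ (-α))
      (C ×ˢ Set.Ioi (0 : ℝ)) (C ×ˢ Set.Ioi (0 : ℝ))) (t : ℝ) (ht : 0 ≤ t) :
    DiffCompletelyMonotone (fun x => B x ^ (-α) * Real.exp (-t * A x / B x)) C C := by
  let D : Set (E × ℝ) := {h | (h.1 ∈ C ∨ h.1 = 0) ∧ 0 ≤ h.2}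
  have hD : ∀ q ∈ C ×ˢ Set.Ioi (0 : ℝ), ∀ h ∈ D, q + h ∈ C ×ˢ Set.Ioi (0 : ℝ) := by
    rintro q hq h ⟨h₁ | h₁, h₂⟩
    · exact ⟨hadd _ hq.1 _ h₁, add_pos_of_pos_of_nonneg (show 0 < q.2 from hq.2) h₂⟩
    · exact ⟨by simpa [h₁] using hq.1, add_pos_of_pos_of_nonneg (show 0 < q.2 from hq.2) h₂⟩
  have hF : DiffCompletelyMonotone (fun q : E × ℝ => (A q.1 + B q.1 * q.2) ^ (-α)) D
      (C ×ˢ Set.Ioi (0 : ℝ)) :=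
    hcm.extend_increments
      (fun q hq s hs => ⟨hcone _ hq.1 s hs, mul_pos hs (show 0 < q.2 from hq.2)⟩) hD
      (fun q hq h hh => ⟨hadd _ hq.1 _ hh.1, add_pos (show 0 < q.2 from hq.2) hh.2⟩)
      hcont (hopen.prod isOpen_Ioi)
  have hFk : ∀ k : ℕ, DiffCompletelyMonotone
      (fun q : E × ℝ => B q.1 ^ k * (A q.1 + B q.1 * q.2) ^ (-(α + k))) D
      (C ×ˢ Set.Ioi (0 : ℝ)) := by
    intro k
    induction k with
    | zero => simpa using hF
    | succ k ih =>
      have hk : 0 < α + k := by positivity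
      have h₁ := ih.of_hasLineDerivAt (v := ((0 : E), (1 : ℝ)))
        (g := fun q => (α + k) * (B q.1 ^ (k + 1) *
          (A q.1 + B q.1 * q.2) ^ (-(α + (k + 1 : ℕ))))) hD
        (fun s hs => ⟨Or.inr (by simp), by simpa using hs.le⟩) fun q hq => by
          have hB := hBpos _ hq.1
          have hA := hApos _ hq.1
          have hy : 0 < q.2 := hq.2
          have h₂ := hasDerivAt_kernel (α := α) (a := A q.1) (b := B q.1) (y := q.2 + 0) k
            (by positivity)
          have h₃ := h₂.comp_const_add q.2 0
          simpa [HasLineDerivAt] using h₃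
      refine (h₁.const_mul (inv_nonneg.2 hk.le)).congr hD fun q _ => ?_
      exact inv_mul_cancel_left₀ hk.ne' _
  have hpos : ∀ t : ℝ, 0 < t →
      DiffCompletelyMonotone (fun x => B x ^ (-α) * Real.exp (-t * A x / B x)) C C := by
    intro t ht
    refine .of_tendsto hadd (fun x hx => tendsto_kernel (hApos x hx) (hBpos x hx) ht) ?_
    filter_upwards [Filter.eventually_gt_atTop 0] with k hk
    have hk' : (0 : ℝ) < k / t := div_pos (Nat.cast_pos.2 hk) ht
    refine DiffCompletelyMonotone.const_mul ?_ (Real.rpow_nonneg hk'.le _)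
    intro l hl x hx
    have h₁ := iterDiff_comp_add (fun x : E => (x, (k : ℝ) / t)) (fun h => (h, 0))
      (fun _ _ => by simp) l
      (fun q : E × ℝ => B q.1 ^ k * (A q.1 + B q.1 * q.2) ^ (-(α + k))) x
    refine h₁ ▸ hFk k _ (fun h hh => ?_) _ ⟨hx, hk'⟩
    obtain ⟨h', hh', rfl⟩ := List.mem_map.1 hh
    exact ⟨Or.inl (hl h' hh'), le_rfl⟩
  rcases ht.eq_or_lt with rfl | ht
  · refine .of_tendsto (p := nhdsWithin (0 : ℝ) (Ioi 0)) hadd (fun x _ => ?_)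
      (by filter_upwards [self_mem_nhdsWithin] with s hs using hpos s hs)
    have h₁ : Continuous fun s : ℝ => B x ^ (-α) * Real.exp (-s * A x / B x) := by fun_prop
    exact (h₁.tendsto 0).mono_left nhdsWithin_le_nhds
  · exact hpos t ht

/-- **Scott–Sokal, Lemma 3.3.** For `α > 0`, an open convex cone `C ⊆ ℝⁿ` and
smooth positive functions `A, B` on `C`, the function `(x,y) ↦ (A(x) + B(x)y)^{−α}` is
completely monotone on `C × ℝ_{>0}` iff `x ↦ B(x)^{−α} e^{−tA(x)/B(x)}` is completely monotone
on `C` for every `t ≥ 0`. -/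
theorem statement15 (n : ℕ) (α : ℝ) (hα : 0 < α)
    (C : Set (Fin n → ℝ)) (hopen : IsOpen C) (hconv : Convex ℝ C)
    (hcone : ∀ x ∈ C, ∀ t : ℝ, 0 < t → t • x ∈ C)
    (A B : (Fin n → ℝ) → ℝ)
    (hApos : ∀ x ∈ C, 0 < A x) (hBpos : ∀ x ∈ C, 0 < B x)
    (hA : ContDiffOn ℝ (⊤ : ℕ∞) A C) (hB : ContDiffOn ℝ (⊤ : ℕ∞) B C) :
    CompletelyMonotoneOn
      (fun q : (Fin n → ℝ) × ℝ => (A q.1 + B q.1 * q.2) ^ (-α))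
      (C ×ˢ Set.Ioi (0 : ℝ)) ↔
    ∀ t : ℝ, 0 ≤ t →
      CompletelyMonotoneOn (fun x => B x ^ (-α) * Real.exp (-t * A x / B x)) C := by
  have hadd : ∀ x ∈ C, ∀ h ∈ C, x + h ∈ C := by
    intro x hx h hh
    have h₁ := hcone _ (hconv hx hh (by norm_num : (0 : ℝ) ≤ 1 / 2)
      (by norm_num : (0 : ℝ) ≤ 1 / 2) (by norm_num)) 2 two_pos
    simpa [smul_add, smul_smul] using h₁
  have hsmooth : ContDiffOn ℝ (⊤ : ℕ∞)
      (fun q : (Fin n → ℝ) × ℝ => (A q.1 + B q.1 * q.2) ^ (-α)) (C ×ˢ Set.Ioi (0 : ℝ)) := by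
    have hmaps : MapsTo Prod.fst (C ×ˢ Set.Ioi (0 : ℝ)) C := fun q hq => hq.1
    refine ((hA.comp contDiffOn_fst hmaps).add
      ((hB.comp contDiffOn_fst hmaps).mul contDiffOn_snd)).rpow_const_of_ne fun q hq => ?_
    have hy : 0 < q.2 := hq.2
    exact (add_pos (hApos _ hq.1) (mul_pos (hBpos _ hq.1) hy)).ne'
  have hsmooth' : ∀ t : ℝ, ContDiffOn ℝ (⊤ : ℕ∞)
      (fun x => B x ^ (-α) * Real.exp (-t * A x / B x)) C := fun t =>
    (hB.rpow_const_of_ne fun x hx => (hBpos x hx).ne').mul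
      ((contDiffOn_const.mul hA).div hB fun x hx => (hBpos x hx).ne').exp
  rw [completelyMonotoneOn_iff_diff (C := C ×ˢ Set.Ioi (0 : ℝ)) (hopen.prod isOpen_Ioi)
    (fun q hq h hh => ⟨hadd _ hq.1 _ hh.1, add_pos (show 0 < q.2 from hq.2) hh.2⟩)
    (fun q hq s hs => ⟨hcone _ hq.1 s hs, mul_pos hs (show 0 < q.2 from hq.2)⟩) hsmooth]
  simp only [completelyMonotoneOn_iff_diff hopen hadd hcone (hsmooth' _)]
  exact ⟨diffCompletelyMonotone_exp_of_rpow hα hopen hadd hcone hApos hBpos hsmooth.continuousOn,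
    diffCompletelyMonotone_rpow_of_exp hα hadd hApos hBpos⟩
end

section
/- Let 2 ≤ m < n be integers and α ≥ 0 a real number, and let E_{m,n}(x) = Σ_{1 ≤ i₁ < ⋯ < i_m ≤ n} x_{i₁}⋯x_{i_m} be the m-th elementary symmetric polynomial in n variables. If E_{m,n}^{−α} is completely monotone on the positive orthant ℝⁿ_{>0}, then α = 0 or α ≥ (n − m)/2. -/
open MeasureTheory Real Set

open Filter Topology

section AbsolutelyMonotone

variable {G : ℕ → ℝ → ℝ} {T : ℝ}

/-- The remainder of order `n` of the Taylor expansion at `0` of `G 0`, where `G k` plays the role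
of the `k`-th derivative. -/
noncomputable def maclaurinRemainder (G : ℕ → ℝ → ℝ) (n : ℕ) (t : ℝ) : ℝ :=
  G 0 t - ∑ k ∈ Finset.range n, G k 0 * t ^ k / (k.factorial : ℝ)

lemma maclaurinRemainder_succ_zero (G : ℕ → ℝ → ℝ) (n : ℕ) :
    maclaurinRemainder G (n + 1) 0 = 0 := by
  simp [maclaurinRemainder, Finset.sum_range_succ']

lemma hasDerivAt_maclaurinRemainder_succ (n : ℕ) {t : ℝ} (hG : HasDerivAt (G 0) (G 1 t) t) :
    HasDerivAt (maclaurinRemainder G (n + 1)) (maclaurinRemainder (fun k => G (k + 1)) n t) t := by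
  unfold maclaurinRemainder
  refine hG.sub ?_
  simp only [Finset.sum_range_succ' _ n]
  have h : HasDerivAt (fun t : ℝ => ∑ k ∈ Finset.range n,
      G (k + 1) 0 * t ^ (k + 1) / ((k + 1).factorial : ℝ))
      (∑ k ∈ Finset.range n, G (k + 1) 0 * t ^ k / (k.factorial : ℝ)) t := by
    refine HasDerivAt.fun_sum fun k _ => ?_
    convert! ((hasDerivAt_pow (k + 1) t).const_mul (G (k + 1) 0)).div_const
      ((k + 1).factorial : ℝ) using 1
    have h1 : ((k + 1 : ℕ) : ℝ) ≠ 0 := by positivity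
    have h2 : (k.factorial : ℝ) ≠ 0 := by positivity
    rw [Nat.factorial_succ]
    push_cast at h1 ⊢
    field_simp
  simpa using h.add_const (G 0 0 * t ^ 0 / ((0 : ℕ).factorial : ℝ))

lemma nonneg_of_hasDerivAt_nonneg {φ φ' : ℝ → ℝ} (h0 : φ 0 = 0)
    (hφ : ∀ t ∈ Ico 0 T, HasDerivAt φ (φ' t) t) (hφ' : ∀ t ∈ Ico 0 T, 0 ≤ φ' t)
    {t : ℝ} (ht : t ∈ Ico 0 T) : 0 ≤ φ t := by
  have hmono : MonotoneOn φ (Ico 0 T) := by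
    refine monotoneOn_of_hasDerivWithinAt_nonneg (f' := φ') (convex_Ico 0 T)
      (fun x hx => (hφ x hx).continuousAt.continuousWithinAt)
      (fun x hx => (hφ x (interior_subset hx)).hasDerivWithinAt)
      (fun x hx => hφ' x (interior_subset hx))
  rw [← h0]
  exact hmono ⟨le_rfl, ht.1.trans_lt ht.2⟩ ht ht.1

lemma maclaurinRemainder_nonneg (n : ℕ) : ∀ {G : ℕ → ℝ → ℝ},
    (∀ k, ∀ t ∈ Ico 0 T, HasDerivAt (G k) (G (k + 1) t) t) →
    (∀ k, ∀ t ∈ Ico 0 T, 0 ≤ G k t) → ∀ t ∈ Ico 0 T, 0 ≤ maclaurinRemainder G n t := by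
  induction n with
  | zero => intro G _ hpos t ht; simpa [maclaurinRemainder] using hpos 0 t ht
  | succ n ih =>
    intro G hG hpos t ht
    exact nonneg_of_hasDerivAt_nonneg (maclaurinRemainder_succ_zero G n)
      (fun t ht => hasDerivAt_maclaurinRemainder_succ n (hG 0 t ht))
      (ih (fun k => hG (k + 1)) (fun k => hpos (k + 1))) ht

lemma maclaurinRemainder_mul_le {r : ℝ} (hr : r ∈ Icc (0 : ℝ) 1) (n : ℕ) : ∀ {G : ℕ → ℝ → ℝ},
    (∀ k, ∀ t ∈ Ico 0 T, HasDerivAt (G k) (G (k + 1) t) t) →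
    (∀ k, ∀ t ∈ Ico 0 T, 0 ≤ G k t) →
    ∀ t ∈ Ico 0 T, maclaurinRemainder G n (r * t) ≤ r ^ n * maclaurinRemainder G n t := by
  have hmem : ∀ t ∈ Ico 0 T, r * t ∈ Ico 0 T := fun t ht =>
    ⟨mul_nonneg hr.1 ht.1, (mul_le_of_le_one_left ht.1 hr.2).trans_lt ht.2⟩
  induction n with
  | zero =>
    intro G hG hpos t ht
    have hmono : MonotoneOn (G 0) (Ico 0 T) :=
      monotoneOn_of_hasDerivWithinAt_nonneg (f' := G 1) (convex_Ico 0 T)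
        (fun x hx => (hG 0 x hx).continuousAt.continuousWithinAt)
        (fun x hx => (hG 0 x (interior_subset hx)).hasDerivWithinAt)
        (fun x hx => hpos 1 x (interior_subset hx))
    simpa [maclaurinRemainder] using hmono (hmem t ht) ht (mul_le_of_le_one_left ht.1 hr.2)
  | succ n ih =>
    intro G hG hpos t ht
    rw [← sub_nonneg]
    refine nonneg_of_hasDerivAt_nonneg (T := T)
      (φ := fun t => r ^ (n + 1) * maclaurinRemainder G (n + 1) t
        - maclaurinRemainder G (n + 1) (r * t))
      (φ' := fun t => r ^ (n + 1) * maclaurinRemainder (fun k => G (k + 1)) n t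
        - maclaurinRemainder (fun k => G (k + 1)) n (r * t) * r)
      (by simp [maclaurinRemainder_succ_zero]) (fun t ht => ?_) (fun t ht => ?_) ht
    · refine ((hasDerivAt_maclaurinRemainder_succ n (hG 0 t ht)).const_mul _).sub ?_
      have h1 : HasDerivAt (fun t : ℝ => r * t) r t := by
        simpa using (hasDerivAt_id t).const_mul r
      exact (hasDerivAt_maclaurinRemainder_succ n (hG 0 _ (hmem t ht))).comp t h1
    · have := mul_le_mul_of_nonneg_right (ih (fun k => hG (k + 1)) (fun k => hpos (k + 1)) t ht) hr.1
      rw [sub_nonneg]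
      calc _ ≤ _ := this
        _ = _ := by ring

/-- S. Bernstein: the Maclaurin series of an absolutely monotone function converges to it. -/
theorem tendsto_maclaurin_of_nonneg (hG : ∀ k, ∀ t ∈ Ico 0 T, HasDerivAt (G k) (G (k + 1) t) t)
    (hpos : ∀ k, ∀ t ∈ Ico 0 T, 0 ≤ G k t) {t : ℝ} (ht : t ∈ Ico 0 T) :
    Tendsto (fun n => ∑ k ∈ Finset.range n, G k 0 * t ^ k / (k.factorial : ℝ)) atTop
      (𝓝 (G 0 t)) := by
  obtain ⟨s, hts, hsT⟩ := exists_between ht.2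
  have hs : s ∈ Ico 0 T := ⟨ht.1.trans hts.le, hsT⟩
  have hs0 : 0 < s := ht.1.trans_lt hts
  have hr : t / s ∈ Icc (0 : ℝ) 1 := ⟨div_nonneg ht.1 hs0.le, (div_le_one hs0).2 hts.le⟩
  have hrem : Tendsto (fun n => maclaurinRemainder G n t) atTop (𝓝 0) := by
    have hgeom : Tendsto (fun n : ℕ => (t / s) ^ n * G 0 s) atTop (𝓝 0) := by
      simpa using (tendsto_pow_atTop_nhds_zero_of_lt_one hr.1
        ((div_lt_one hs0).2 hts)).mul_const (G 0 s)
    refine squeeze_zero (fun n => maclaurinRemainder_nonneg n hG hpos t ht) (fun n => ?_) hgeom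
    have h := maclaurinRemainder_mul_le hr n hG hpos s hs
    rw [div_mul_cancel₀ _ hs0.ne'] at h
    refine h.trans (mul_le_mul_of_nonneg_left ?_ (pow_nonneg hr.1 n))
    refine sub_le_self _ (Finset.sum_nonneg fun k _ => ?_)
    have := hpos k 0 ⟨le_rfl, hs0.trans hsT⟩
    positivity
  have := hrem.const_sub (G 0 t)
  simpa [maclaurinRemainder] using this

end AbsolutelyMonotone

section DirDeriv

variable {E : Type*} [NormedAddCommGroup E] [NormedSpace ℝ E] {f : E → ℝ} {C : Set E}

lemma differentiableAt_iteratedFDeriv_of_mem (hC : IsOpen C) (hf : ContDiffOn ℝ (⊤ : ℕ∞) f C)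
    (k : ℕ) {x : E} (hx : x ∈ C) : DifferentiableAt ℝ (iteratedFDeriv ℝ k f) x :=
  (hf.contDiffAt (hC.mem_nhds hx)).differentiableAt_iteratedFDeriv
    (by exact_mod_cast ENat.natCast_lt_top k)

lemma iterDirDeriv_eq_iteratedFDeriv (hC : IsOpen C) (hf : ContDiffOn ℝ (⊤ : ℕ∞) f C) (k : ℕ) :
    ∀ (v : ℕ → E), ∀ x ∈ C, iterDirDeriv k v f x = iteratedFDeriv ℝ k f x (fun i => v i) := by
  induction k with
  | zero => intro v x _; simp [iterDirDeriv]
  | succ k ih =>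
    intro v x hx
    have hev : iterDirDeriv k (fun i => v (i + 1)) f =ᶠ[𝓝 x]
        fun y => iteratedFDeriv ℝ k f y (fun i : Fin k => v (i + 1)) := by
      filter_upwards [hC.mem_nhds hx] with y hy using ih _ y hy
    rw [(differentiableAt_iteratedFDeriv_of_mem hC hf k hx).iteratedFDeriv_succ_apply_left']
    change fderiv ℝ (iterDirDeriv k (fun i => v (i + 1)) f) x (v 0) = _
    rw [hev.fderiv_eq]
    rfl

lemma hasDerivAt_iteratedFDeriv_sub_smul (hC : IsOpen C) (hf : ContDiffOn ℝ (⊤ : ℕ∞) f C)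
    (k : ℕ) {p z : E} {t : ℝ} (ht : p - t • z ∈ C) :
    HasDerivAt (fun t : ℝ => (-1 : ℝ) ^ k * iteratedFDeriv ℝ k f (p - t • z) (fun _ => z))
      ((-1 : ℝ) ^ (k + 1) * iteratedFDeriv ℝ (k + 1) f (p - t • z) (fun _ => z)) t := by
  have hd := differentiableAt_iteratedFDeriv_of_mem hC hf k ht
  rw [hd.iteratedFDeriv_succ_apply_left']
  have hd' : DifferentiableAt ℝ (fun y => iteratedFDeriv ℝ k f y (fun _ => z)) (p - t • z) := by
    fun_prop
  have hline : HasDerivAt (fun t : ℝ => p - t • z) (-z) t := by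
    simpa using ((hasDerivAt_id t).smul_const z).const_sub p
  have h := (hd'.hasFDerivAt.comp_hasDerivAt t hline).const_mul ((-1 : ℝ) ^ k)
  convert! h using 1
  simp only [map_neg, pow_succ]
  have : (Fin.tail fun _ : Fin (k + 1) => z) = fun _ => z := rfl
  rw [this]
  ring

end DirDeriv

/-- A function on a positive orthant is exponentially convex if its kernel `f (u + v)` is positive
semidefinite. -/
def ExpConvexOnOrthant {n : ℕ} (f : (Fin n → ℝ) → ℝ) : Prop :=
  ∀ (ι : Type) [Fintype ι] (c : ι → ℝ) (u : ι → Fin n → ℝ), (∀ a k, 0 < u a k) →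
    0 ≤ ∑ a, ∑ b, c a * c b * f (u a + u b)

lemma isOpen_orthant (n : ℕ) : IsOpen {x : Fin n → ℝ | ∀ i, 0 < x i} := by
  simp only [Set.ofPred_forall]
  exact isOpen_iInter_of_finite fun i => isOpen_lt continuous_const (continuous_apply i)

section CompletelyMonotone

variable {n : ℕ} {f : (Fin n → ℝ) → ℝ}

lemma CompletelyMonotoneOn.iteratedFDeriv_single_nonneg
    (hf : CompletelyMonotoneOn f {x : Fin n → ℝ | ∀ i, 0 < x i}) {p : Fin n → ℝ}
    (hp : ∀ i, 0 < p i) (k : ℕ) (r : Fin k → Fin n) :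
    0 ≤ (-1 : ℝ) ^ k * iteratedFDeriv ℝ k f p (fun l => Pi.single (r l) 1) := by
  have hcont : Continuous fun ε : ℝ => (-1 : ℝ) ^ k *
      iteratedFDeriv ℝ k f p (fun l => Pi.single (r l) 1 + ε • (fun _ => 1)) := by
    fun_prop
  have hlim := (hcont.tendsto 0).mono_left (nhdsWithin_le_nhds (s := Ioi 0))
  simp only [zero_smul, add_zero] at hlim
  refine ge_of_tendsto hlim ?_
  filter_upwards [self_mem_nhdsWithin] with ε hε
  have hε' : 0 < ε := hε
  let v : ℕ → Fin n → ℝ := fun l =>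
    (if h : l < k then Pi.single (r ⟨l, h⟩) 1 else 0) + ε • (fun _ => 1)
  have hv : ∀ l, v l ∈ {x : Fin n → ℝ | ∀ i, 0 < x i} := by
    intro l i
    have : 0 ≤ (if h : l < k then (Pi.single (r ⟨l, h⟩) 1 : Fin n → ℝ) else 0) i := by
      split_ifs
      · rw [Pi.single_apply]; split_ifs <;> simp
      · simp
    simp only [v, Pi.add_apply, Pi.smul_apply, smul_eq_mul, mul_one]
    linarith
  have h := hf.2 k v hv p hp
  rw [iterDirDeriv_eq_iteratedFDeriv (isOpen_orthant n) hf.1 k v p hp] at h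
  simpa [v] using h

lemma iteratedFDeriv_mul_const_eq_sum (k : ℕ) (p z : Fin n → ℝ) :
    iteratedFDeriv ℝ k f p (fun _ => z) =
      ∑ r : Fin k → Fin n, (∏ l, z (r l)) *
        iteratedFDeriv ℝ k f p (fun l => Pi.single (r l) 1) := by
  have hz : z = ∑ i, z i • (Pi.single i 1 : Fin n → ℝ) := by
    ext j
    simp [Finset.sum_apply, Pi.single_apply]
  calc iteratedFDeriv ℝ k f p (fun _ => z)
      = iteratedFDeriv ℝ k f p (fun _ => ∑ i, z i • (Pi.single i 1 : Fin n → ℝ)) := by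
        rw [← hz]
    _ = _ := by
      rw [ContinuousMultilinearMap.map_sum]
      refine Finset.sum_congr rfl fun r _ => ?_
      rw [ContinuousMultilinearMap.map_smul_univ, smul_eq_mul]

lemma CompletelyMonotoneOn.sum_iteratedFDeriv_nonneg
    (hf : CompletelyMonotoneOn f {x : Fin n → ℝ | ∀ i, 0 < x i}) {p : Fin n → ℝ}
    (hp : ∀ i, 0 < p i) (k : ℕ) {ι : Type*} [Fintype ι] (c : ι → ℝ) (z : ι → Fin n → ℝ) :
    0 ≤ ∑ a, ∑ b, c a * c b *
      ((-1 : ℝ) ^ k * iteratedFDeriv ℝ k f p (fun _ => z a * z b)) := by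
  have key : ∑ a, ∑ b, c a * c b *
      ((-1 : ℝ) ^ k * iteratedFDeriv ℝ k f p (fun _ => z a * z b)) =
      ∑ r : Fin k → Fin n, (∑ a, c a * ∏ l, z a (r l)) ^ 2 *
        ((-1 : ℝ) ^ k * iteratedFDeriv ℝ k f p (fun l => Pi.single (r l) 1)) := by
    have h1 : ∀ r : Fin k → Fin n, (∑ a, c a * ∏ l, z a (r l)) ^ 2 *
        ((-1 : ℝ) ^ k * iteratedFDeriv ℝ k f p (fun l => Pi.single (r l) 1)) =
        ∑ a, ∑ b, c a * c b * ((∏ l, (z a * z b) (r l)) *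
          ((-1 : ℝ) ^ k * iteratedFDeriv ℝ k f p (fun l => Pi.single (r l) 1))) := by
      intro r
      rw [sq, Finset.sum_mul_sum, Finset.sum_mul]
      refine Finset.sum_congr rfl fun a _ => ?_
      rw [Finset.sum_mul]
      refine Finset.sum_congr rfl fun b _ => ?_
      simp only [Pi.mul_apply, Finset.prod_mul_distrib]
      ring
    simp_rw [h1]
    symm
    rw [Finset.sum_comm]
    refine Finset.sum_congr rfl fun a _ => ?_
    rw [Finset.sum_comm]
    refine Finset.sum_congr rfl fun b _ => ?_
    rw [iteratedFDeriv_mul_const_eq_sum k p (z a * z b), Finset.mul_sum, Finset.mul_sum]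
    refine Finset.sum_congr rfl fun r _ => ?_
    ring
  rw [key]
  exact Finset.sum_nonneg fun r _ =>
    mul_nonneg (sq_nonneg _) (hf.iteratedFDeriv_single_nonneg hp k r)

lemma CompletelyMonotoneOn.tendsto_taylor
    (hf : CompletelyMonotoneOn f {x : Fin n → ℝ | ∀ i, 0 < x i}) {p z : Fin n → ℝ}
    (hz : ∀ i, 0 < z i) (hpz : ∀ i, z i < p i) :
    Tendsto (fun N => ∑ k ∈ Finset.range N,
      (-1 : ℝ) ^ k * iteratedFDeriv ℝ k f p (fun _ => z) / (k.factorial : ℝ)) atTop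
      (𝓝 (f (p - z))) := by
  obtain ⟨T, hT1, hT⟩ : ∃ T : ℝ, 1 < T ∧ ∀ i, T * z i < p i := by
    have hev : ∀ᶠ T : ℝ in 𝓝[>] 1, ∀ i, T * z i < p i := by
      rw [eventually_all]
      intro i
      have : Tendsto (fun T : ℝ => T * z i) (𝓝[>] 1) (𝓝 (1 * z i)) :=
        (tendsto_id.mono_left nhdsWithin_le_nhds).mul_const _
      exact this.eventually_lt_const (by simpa using hpz i)
    obtain ⟨T, h1, h2⟩ := (hev.and self_mem_nhdsWithin).exists
    exact ⟨T, h2, h1⟩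
  have hmem : ∀ t ∈ Ico 0 T, p - t • z ∈ {x : Fin n → ℝ | ∀ i, 0 < x i} := by
    intro t ht i
    have : t * z i ≤ T * z i := mul_le_mul_of_nonneg_right ht.2.le (hz i).le
    simp only [Pi.sub_apply, Pi.smul_apply, smul_eq_mul]
    linarith [hT i]
  have h := tendsto_maclaurin_of_nonneg (T := T)
    (G := fun k t => (-1 : ℝ) ^ k * iteratedFDeriv ℝ k f (p - t • z) (fun _ => z))
    (fun k t ht => hasDerivAt_iteratedFDeriv_sub_smul (isOpen_orthant n) hf.1 k (hmem t ht))
    (fun k t ht => by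
      have h := hf.2 k (fun _ => z) (fun _ => hz) _ (hmem t ht)
      rwa [iterDirDeriv_eq_iteratedFDeriv (isOpen_orthant n) hf.1 k _ _ (hmem t ht)] at h)
    (t := 1) ⟨zero_le_one, hT1⟩
  simpa using h

lemma CompletelyMonotoneOn.sum_sub_mul_nonneg
    (hf : CompletelyMonotoneOn f {x : Fin n → ℝ | ∀ i, 0 < x i}) {ι : Type*} [Fintype ι]
    {p : Fin n → ℝ} (hp : ∀ i, 0 < p i) (c : ι → ℝ) (z : ι → Fin n → ℝ)
    (hz : ∀ a i, 0 < z a i) (hpz : ∀ a b i, z a i * z b i < p i) :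
    0 ≤ ∑ a, ∑ b, c a * c b * f (p - z a * z b) := by
  have hlim : Tendsto (fun N => ∑ a, ∑ b, c a * c b * ∑ k ∈ Finset.range N,
      (-1 : ℝ) ^ k * iteratedFDeriv ℝ k f p (fun _ => z a * z b) / (k.factorial : ℝ)) atTop
      (𝓝 (∑ a, ∑ b, c a * c b * f (p - z a * z b))) :=
    tendsto_finsetSum _ fun a _ => tendsto_finsetSum _ fun b _ =>
      (hf.tendsto_taylor (fun i => mul_pos (hz a i) (hz b i)) (hpz a b)).const_mul _
  refine ge_of_tendsto' hlim fun N => ?_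
  have : ∑ a, ∑ b, c a * c b * ∑ k ∈ Finset.range N,
      (-1 : ℝ) ^ k * iteratedFDeriv ℝ k f p (fun _ => z a * z b) / (k.factorial : ℝ) =
      ∑ k ∈ Finset.range N, (∑ a, ∑ b, c a * c b *
        ((-1 : ℝ) ^ k * iteratedFDeriv ℝ k f p (fun _ => z a * z b))) / (k.factorial : ℝ) := by
    simp_rw [Finset.mul_sum, Finset.sum_div]
    symm
    rw [Finset.sum_comm]
    refine Finset.sum_congr rfl fun a _ => ?_
    rw [Finset.sum_comm]
    refine Finset.sum_congr rfl fun b _ => Finset.sum_congr rfl fun k _ => ?_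
    ring
  rw [this]
  exact Finset.sum_nonneg fun k _ =>
    div_nonneg (hf.sum_iteratedFDeriv_nonneg hp k c z) (by positivity)

theorem CompletelyMonotoneOn.expConvexOnOrthant
    (hf : CompletelyMonotoneOn f {x : Fin n → ℝ | ∀ i, 0 < x i}) : ExpConvexOnOrthant f := by
  intro ι _ c u hu
  have hlim : Tendsto (fun h : ℝ => ∑ a, ∑ b, c a * c b * f (u a + u b - h • (u a * u b)))
      (𝓝[>] 0) (𝓝 (∑ a, ∑ b, c a * c b * f (u a + u b))) := by
    refine tendsto_finsetSum _ fun a _ => tendsto_finsetSum _ fun b _ => Tendsto.const_mul _ ?_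
    have hmem : u a + u b ∈ {x : Fin n → ℝ | ∀ i, 0 < x i} := fun i => add_pos (hu a i) (hu b i)
    have hc := hf.1.continuousOn.continuousAt ((isOpen_orthant n).mem_nhds hmem)
    refine hc.tendsto.comp (Tendsto.mono_left ?_ nhdsWithin_le_nhds)
    have : Continuous fun h : ℝ => u a + u b - h • (u a * u b) := by fun_prop
    simpa using this.tendsto 0
  refine ge_of_tendsto hlim ?_
  have hsmall : ∀ᶠ h : ℝ in 𝓝[>] 0, ∀ a i, h * u a i < 1 := by
    rw [eventually_all]; intro a
    rw [eventually_all]; intro i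
    have : Tendsto (fun h : ℝ => h * u a i) (𝓝[>] 0) (𝓝 (0 * u a i)) :=
      (tendsto_id.mono_left nhdsWithin_le_nhds).mul_const _
    exact this.eventually_lt_const (by simp)
  filter_upwards [hsmall, self_mem_nhdsWithin] with h hh h0
  have h0' : 0 < h := h0
  have hs : √(h⁻¹) * √(h⁻¹) = h⁻¹ := Real.mul_self_sqrt (by positivity)
  have hmul : ∀ a b i, (√(h⁻¹) * (1 - h * u a i)) * (√(h⁻¹) * (1 - h * u b i)) =
      h⁻¹ - (u a i + u b i - h * (u a i * u b i)) := by
    intro a b i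
    calc _ = √(h⁻¹) * √(h⁻¹) * ((1 - h * u a i) * (1 - h * u b i)) := by ring
      _ = _ := by rw [hs]; field_simp; ring
  have key := hf.sum_sub_mul_nonneg (p := fun _ => h⁻¹) (fun _ => by positivity) c
    (fun a i => √(h⁻¹) * (1 - h * u a i))
    (fun a i => mul_pos (by positivity) (sub_pos.2 (hh a i)))
    (fun a b i => by
      rw [hmul]
      nlinarith [hu a i, hu b i, mul_pos (hu b i) (sub_pos.2 (hh a i))])
  have heq : ∀ a b, u a + u b - h • (u a * u b) = (fun _ => h⁻¹) -
      (fun i => √(h⁻¹) * (1 - h * u a i)) * (fun i => √(h⁻¹) * (1 - h * u b i)) := by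
    intro a b
    ext i
    simp only [Pi.sub_apply, Pi.add_apply, Pi.smul_apply, Pi.mul_apply, smul_eq_mul, hmul]
    ring
  simp_rw [heq]
  exact key

end CompletelyMonotone

section Esymm

/-- The value at `x` of the `m`-th elementary symmetric polynomial. -/
noncomputable def esymmEval {n : ℕ} (m : ℕ) (x : Fin n → ℝ) : ℝ :=
  ∑ S ∈ Finset.powersetCard m (Finset.univ : Finset (Fin n)), ∏ i ∈ S, x i

lemma esymmEval_zero {n : ℕ} (x : Fin n → ℝ) : esymmEval 0 x = 1 := by
  simp [esymmEval]

lemma esymmEval_one {n : ℕ} (x : Fin n → ℝ) : esymmEval 1 x = ∑ i, x i := by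
  simp [esymmEval, Finset.powersetCard_one]

lemma esymmEval_cons {n : ℕ} (m : ℕ) (X : ℝ) (x : Fin n → ℝ) :
    esymmEval (m + 1) (Fin.cons X x : Fin (n + 1) → ℝ) =
      X * esymmEval m x + esymmEval (m + 1) x := by
  simp only [esymmEval]
  have hval : (Finset.univ.val.map (Fin.cons X x : Fin (n + 1) → ℝ)) =
      X ::ₘ Finset.univ.val.map x := by
    simp [Fin.univ_succ]
  have h := fun (k : ℕ) (y : Fin n → ℝ) => Finset.esymm_map_val y Finset.univ k
  have h' := fun (k : ℕ) (y : Fin (n + 1) → ℝ) => Finset.esymm_map_val y Finset.univ k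
  rw [← h', ← h, ← h, hval]
  simp only [Multiset.esymm, Multiset.powersetCard_cons, Multiset.map_add, Multiset.sum_add,
    Multiset.map_map, Function.comp_def, Multiset.prod_cons, Multiset.sum_map_mul_left]
  ring

lemma esymmEval_pos {n m : ℕ} (hmn : m ≤ n) {x : Fin n → ℝ} (hx : ∀ i, 0 < x i) :
    0 < esymmEval m x := by
  refine Finset.sum_pos (fun S _ => Finset.prod_pos fun i _ => hx i) ?_
  rw [Finset.powersetCard_nonempty]
  simpa using hmn

lemma esymmEval_two {n : ℕ} (x : Fin n → ℝ) :
    esymmEval 2 x = ((∑ i, x i) ^ 2 - ∑ i, x i ^ 2) / 2 := by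
  induction n with
  | zero =>
    rw [esymmEval, Finset.powersetCard_eq_empty.2 (by simp)]
    simp
  | succ n ih =>
    rw [← Fin.cons_self_tail x, esymmEval_cons, ih, esymmEval_one]
    simp only [Fin.sum_univ_succ, Fin.cons_zero, Fin.cons_succ]
    ring

lemma ExpConvexOnOrthant.esymmEval_pred {n m : ℕ} (hmn : m ≤ n) {α : ℝ}
    (hf : ExpConvexOnOrthant fun x : Fin (n + 1) → ℝ => esymmEval (m + 1) x ^ (-α)) :
    ExpConvexOnOrthant fun x : Fin n → ℝ => esymmEval m x ^ (-α) := by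
  intro ι _ c u hu
  have hlim : Tendsto (fun h : ℝ => ∑ a, ∑ b, c a * c b *
      (esymmEval m (u a + u b) + h * esymmEval (m + 1) (u a + u b)) ^ (-α))
      (𝓝[>] 0) (𝓝 (∑ a, ∑ b, c a * c b * esymmEval m (u a + u b) ^ (-α))) := by
    refine tendsto_finsetSum _ fun a _ => tendsto_finsetSum _ fun b _ => Tendsto.const_mul _ ?_
    have hpos : 0 < esymmEval m (u a + u b) := esymmEval_pos hmn fun i => add_pos (hu a i) (hu b i)
    have h1 : Tendsto (fun h : ℝ => esymmEval m (u a + u b) + h * esymmEval (m + 1) (u a + u b))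
        (𝓝[>] 0) (𝓝 (esymmEval m (u a + u b))) := by
      have : Continuous fun h : ℝ =>
        esymmEval m (u a + u b) + h * esymmEval (m + 1) (u a + u b) := by fun_prop
      simpa using (this.tendsto 0).mono_left (nhdsWithin_le_nhds (s := Ioi 0))
    exact h1.rpow_const (Or.inl hpos.ne')
  refine ge_of_tendsto hlim ?_
  filter_upwards [self_mem_nhdsWithin] with h h0
  have h0' : 0 < h := h0
  have key := hf ι c (fun a => Fin.cons (h⁻¹ / 2) (u a)) (fun a k => by
    refine Fin.cases ?_ (fun i => ?_) k
    · simp only [Fin.cons_zero]; positivity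
    · simpa using hu a i)
  have hterm : ∀ a b, esymmEval (m + 1)
      ((Fin.cons (h⁻¹ / 2) (u a) : Fin (n + 1) → ℝ) + Fin.cons (h⁻¹ / 2) (u b)) ^ (-α) =
      h⁻¹ ^ (-α) * (esymmEval m (u a + u b) + h * esymmEval (m + 1) (u a + u b)) ^ (-α) := by
    intro a b
    have hcons : (Fin.cons (h⁻¹ / 2) (u a) : Fin (n + 1) → ℝ) + Fin.cons (h⁻¹ / 2) (u b) =
        Fin.cons h⁻¹ (u a + u b) := by
      ext k
      refine Fin.cases ?_ (fun i => ?_) k <;> simp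
    have hpos : ∀ i, 0 < (u a + u b) i := fun i => add_pos (hu a i) (hu b i)
    have h2 : 0 ≤ esymmEval (m + 1) (u a + u b) :=
      Finset.sum_nonneg fun S _ => Finset.prod_nonneg fun i _ => (hpos i).le
    have h3 := esymmEval_pos hmn hpos
    rw [hcons, esymmEval_cons, ← Real.mul_rpow (by positivity) (by positivity)]
    congr 1
    field_simp
  simp only [hterm] at key
  have hfac : 0 < h⁻¹ ^ (-α) := by positivity
  refine nonneg_of_mul_nonneg_right ?_ hfac
  convert! key using 1
  simp only [Finset.mul_sum]
  refine Finset.sum_congr rfl fun a _ => Finset.sum_congr rfl fun b _ => ?_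
  ring

lemma ExpConvexOnOrthant.esymmEval_two_of_add {N : ℕ} (hN : 2 ≤ N) {α : ℝ} (j : ℕ)
    (hf : ExpConvexOnOrthant fun x : Fin (N + j) → ℝ => esymmEval (2 + j) x ^ (-α)) :
    ExpConvexOnOrthant fun x : Fin N → ℝ => esymmEval 2 x ^ (-α) := by
  induction j with
  | zero => exact hf
  | succ j ih => exact ih (ExpConvexOnOrthant.esymmEval_pred (by omega) hf)

end Esymm

section Lorentz

open Asymptotics

lemma one_add_rpow_neg_sub_isBigO (α : ℝ) :
    (fun y : ℝ => (1 + y) ^ (-α) - (1 - α * y + α * (α + 1) / 2 * y ^ 2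
      - α * (α + 1) * (α + 2) / 6 * y ^ 3 + α * (α + 1) * (α + 2) * (α + 3) / 24 * y ^ 4))
      =O[𝓝 0] fun y => y ^ 5 := by
  have h := (Real.one_add_rpow_hasFPowerSeriesAt_zero (a := -α)).isBigO_sub_partialSum_pow 5
  have h' : (fun y : ℝ => ‖y‖ ^ 5) =O[𝓝 0] fun y : ℝ => y ^ 5 :=
    .of_norm_left (by simpa using isBigO_refl (fun y : ℝ => |y| ^ 5) (𝓝 0) |>.trans (by
      refine isBigO_of_le _ fun y => by simp))
  refine (h.trans h').congr_left fun y => ?_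
  have hc : ∀ k, Ring.choose (-α) k = (descPochhammer ℤ k).smeval (-α) / (k.factorial : ℝ) := by
    intro k
    rw [Ring.descPochhammer_eq_factorial_smul_choose, nsmul_eq_mul]
    field_simp
  simp only [zero_add, FormalMultilinearSeries.partialSum, binomialSeries_apply,
    Finset.sum_range_succ, Finset.sum_range_zero, hc, descPochhammer_succ_right]
  have h_two : (2 : Polynomial ℤ).smeval (-α) = 2 := by
    simpa using Polynomial.smeval_natCast ℤ (-α) 2
  have h_three : (3 : Polynomial ℤ).smeval (-α) = 3 := by
    simpa using Polynomial.smeval_natCast ℤ (-α) 3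
  simp [Polynomial.smeval_mul, Polynomial.smeval_sub, Nat.factorial, h_two, h_three]
  ring

/-- The degree four Taylor polynomial in `h` of `((1 + h A) ^ 2 - h ^ 2 s) ^ (-α)`. -/
noncomputable def lorentzTaylor (α A s h : ℝ) : ℝ :=
  1 - 2 * α * A * h + (α * (α + 1) / 2 * (4 * A ^ 2) - α * (A ^ 2 - s)) * h ^ 2
    + (α * (α + 1) / 2 * (4 * A * (A ^ 2 - s))
      - α * (α + 1) * (α + 2) / 6 * (8 * A ^ 3)) * h ^ 3
    + (α * (α + 1) / 2 * (A ^ 2 - s) ^ 2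
      - α * (α + 1) * (α + 2) / 6 * (12 * A ^ 2 * (A ^ 2 - s))
      + α * (α + 1) * (α + 2) * (α + 3) / 24 * (16 * A ^ 4)) * h ^ 4

lemma lorentz_rpow_sub_taylor_isBigO (α A s : ℝ) :
    (fun h : ℝ => ((1 + h * A) ^ 2 - h ^ 2 * s) ^ (-α) - lorentzTaylor α A s h)
      =O[𝓝 0] fun h => h ^ 5 := by
  set q := A ^ 2 - s with hq
  have hcont : Continuous fun h : ℝ => h * (2 * A + h * q) := by fun_prop
  have hg0 : Tendsto (fun h : ℝ => h * (2 * A + h * q)) (𝓝 0) (𝓝 0) := by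
    simpa using hcont.tendsto 0
  have hbdd : ∀ r : ℝ → ℝ, Continuous r → (fun h : ℝ => h ^ 5 * r h) =O[𝓝 0] fun h => h ^ 5 := by
    intro r hr
    have h1 : r =O[𝓝 0] fun _ => (1 : ℝ) := (hr.tendsto 0).isBigO_one ℝ
    simpa using (isBigO_refl (fun h : ℝ => h ^ 5) (𝓝 0)).mul h1
  have h1 := (one_add_rpow_neg_sub_isBigO α).comp_tendsto hg0
  have h2 : ((fun y : ℝ => y ^ 5) ∘ fun h : ℝ => h * (2 * A + h * q)) =O[𝓝 0]
      fun h => h ^ 5 := by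
    refine (hbdd (fun h => (2 * A + h * q) ^ 5) (by fun_prop)).congr_left fun h => ?_
    simp only [Function.comp]
    ring
  have h3 := hbdd (fun h => - α * (α + 1) * (α + 2) / 6 * (6 * A * q ^ 2 + h * q ^ 3)
    + α * (α + 1) * (α + 2) * (α + 3) / 24 *
      (32 * A ^ 3 * q + 24 * A ^ 2 * q ^ 2 * h + 8 * A * q ^ 3 * h ^ 2 + q ^ 4 * h ^ 3))
    (by fun_prop)
  refine ((h1.trans h2).add h3).congr_left fun h => ?_
  have : (1 + h * A) ^ 2 - h ^ 2 * s = 1 + h * (2 * A + h * q) := by rw [hq]; ring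
  rw [this]
  simp only [Function.comp, lorentzTaylor, ← hq]
  ring

variable {N : ℕ}

/-- Weights of the finite-difference functional approximating `κ ∂ₜ² - Δ`. -/
def probeWeight (N : ℕ) (κ : ℝ) : Option (Bool × Option (Fin N)) → ℝ
  | none => 2 * N - 2 * κ
  | some (_, none) => κ
  | some (_, some _) => -1

/-- Components along `(1, …, 1)` of the nodes of the finite-difference functional. -/
def probeRadial : Option (Bool × Option (Fin N)) → ℝ
  | none => 0
  | some (b, none) => cond b 1 (-1)
  | some (_, some _) => 0

/-- Components orthogonal to `(1, …, 1)` of the nodes of the finite-difference functional. -/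
noncomputable def probeSpatial : Option (Bool × Option (Fin N)) → Fin N → ℝ
  | none => 0
  | some (_, none) => 0
  | some (b, some k) => fun l => cond b 1 (-1) * ((if l = k then 1 else 0) - (N : ℝ)⁻¹)

lemma sum_probeSpatial (hN : N ≠ 0) (i : Option (Bool × Option (Fin N))) :
    ∑ l, probeSpatial i l = 0 := by
  have : (N : ℝ) ≠ 0 := by exact_mod_cast hN
  rcases i with _ | ⟨b, _ | k⟩
  · simp [probeSpatial]
  · simp [probeSpatial]
  · simp [probeSpatial, ← Finset.mul_sum, this]

lemma esymmEval_two_lorentz (hN : 2 ≤ N) (A h : ℝ) {v : Fin N → ℝ} (hv : ∑ l, v l = 0) :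
    esymmEval 2 (fun l => 1 + h * A + h * v l) =
      (N * (N - 1) / 2) * ((1 + h * A) ^ 2 - h ^ 2 * ((∑ l, v l ^ 2) / (N * (N - 1)))) := by
  have h1 : (2 : ℝ) ≤ N := by exact_mod_cast hN
  have h2 : (N : ℝ) - 1 ≠ 0 := by linarith
  have h3 : (N : ℝ) ≠ 0 := by linarith
  have hsum : ∑ l, (1 + h * A + h * v l) = N * (1 + h * A) := by
    rw [Finset.sum_add_distrib, ← Finset.mul_sum, hv]
    simp
    ring
  have hsq : ∑ l, (1 + h * A + h * v l) ^ 2 =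
      N * (1 + h * A) ^ 2 + h ^ 2 * ∑ l, v l ^ 2 := by
    have : ∀ l, (1 + h * A + h * v l) ^ 2 =
        (1 + h * A) ^ 2 + 2 * (1 + h * A) * h * v l + h ^ 2 * v l ^ 2 := fun l => by ring
    simp_rw [this, Finset.sum_add_distrib, ← Finset.mul_sum, hv]
    simp
  rw [esymmEval_two, hsum, hsq]
  field_simp
  ring

lemma sum_sq_spatial (hN : N ≠ 0) (s t : ℝ) (k l : Fin N) :
    ∑ j, (s * ((if j = k then 1 else 0) - (N : ℝ)⁻¹)
      + t * ((if j = l then 1 else 0) - (N : ℝ)⁻¹)) ^ 2 =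
      s ^ 2 + t ^ 2 + 2 * s * t * (if k = l then 1 else 0) - (s + t) ^ 2 * (N : ℝ)⁻¹ := by
  have h0 : (N : ℝ) ≠ 0 := by exact_mod_cast hN
  have : ∀ j, (s * ((if j = k then 1 else 0) - (N : ℝ)⁻¹)
      + t * ((if j = l then 1 else 0) - (N : ℝ)⁻¹)) ^ 2 =
      (if j = k then s ^ 2 - 2 * s * (s + t) * (N : ℝ)⁻¹
        + (if j = l then 2 * s * t else 0) else 0) +
      (if j = l then t ^ 2 - 2 * t * (s + t) * (N : ℝ)⁻¹ else 0)
        + ((s + t) * (N : ℝ)⁻¹) ^ 2 := by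
    intro j
    split_ifs <;> ring
  simp_rw [this, Finset.sum_add_distrib]
  simp
  split_ifs <;> field_simp <;> ring

lemma sum_sum_ite_eq (a b : ℝ) :
    ∑ k : Fin N, ∑ l : Fin N, (if k = l then a else b) = N * a + N * (N - 1) * b := by
  have : ∀ k l : Fin N, (if k = l then a else b) = (if k = l then a - b else 0) + b := by
    intro k l; split_ifs <;> ring
  simp_rw [this, Finset.sum_add_distrib]
  simp
  ring

/-- The double sum of the finite-difference functional against a kernel depending on the radial
part and the squared norm of the spatial part. -/
noncomputable def probeForm (N κ : ℝ) (Φ : ℝ → ℝ → ℝ) : ℝ :=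
  (2 * N - 2 * κ) ^ 2 * Φ 0 0 + 2 * (2 * N - 2 * κ) * κ * (Φ 1 0 + Φ (-1) 0)
    + κ ^ 2 * (Φ 2 0 + 2 * Φ 0 0 + Φ (-2) 0)
    - 4 * N * (2 * N - 2 * κ) * Φ 0 (1 - N⁻¹) - 4 * N * κ * (Φ 1 (1 - N⁻¹) + Φ (-1) (1 - N⁻¹))
    + 2 * (N * (Φ 0 (4 - 4 * N⁻¹) + Φ 0 0) + N * (N - 1) * (Φ 0 (2 - 4 * N⁻¹) + Φ 0 2))

lemma sum_probe_eq_probeForm (hN : N ≠ 0) (κ : ℝ) (Φ : ℝ → ℝ → ℝ) :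
    ∑ i : Option (Bool × Option (Fin N)), ∑ j : Option (Bool × Option (Fin N)),
      probeWeight N κ i * probeWeight N κ j *
        Φ (probeRadial i + probeRadial j) (∑ l, (probeSpatial i l + probeSpatial j l) ^ 2) =
      probeForm N κ Φ := by
  have hnorm : ∀ (s : ℝ) (hs : s ^ 2 = 1) (k : Fin N),
      ∑ j, (s * ((if j = k then 1 else 0) - (N : ℝ)⁻¹)) ^ 2 = 1 - (N : ℝ)⁻¹ := by
    intro s hs k
    have := sum_sq_spatial hN s 0 k k
    simpa [hs] using this
  have hpair : ∀ (s t : ℝ) (k l : Fin N),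
      Φ 0 (∑ j, (s * ((if j = k then 1 else 0) - (N : ℝ)⁻¹)
        + t * ((if j = l then 1 else 0) - (N : ℝ)⁻¹)) ^ 2) =
      if k = l then Φ 0 (s ^ 2 + t ^ 2 + 2 * s * t - (s + t) ^ 2 * (N : ℝ)⁻¹)
        else Φ 0 (s ^ 2 + t ^ 2 - (s + t) ^ 2 * (N : ℝ)⁻¹) := by
    intro s t k l
    rw [sum_sq_spatial hN]
    split_ifs <;> simp
  have h1 := hnorm 1 (by norm_num)
  have h2 := hnorm (-1) (by norm_num)
  have p1 := hpair 1 1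
  have p2 := hpair 1 (-1)
  have p3 := hpair (-1) 1
  have p4 := hpair (-1) (-1)
  simp only [Fintype.sum_option, Fintype.sum_prod_type, Fintype.sum_bool, probeWeight,
    probeRadial, probeSpatial, cond_true, cond_false, Pi.zero_apply, add_zero, zero_add,
    h1, h2, p1, p2, p3, p4, Finset.sum_add_distrib, ← Finset.mul_sum, sum_sum_ite_eq,
    Finset.sum_const, Finset.card_univ, Fintype.card_fin, nsmul_eq_mul]
  norm_num [probeForm]
  ring

lemma ExpConvexOnOrthant.probeForm_nonneg (hN : 2 ≤ N) {α : ℝ} (κ : ℝ)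
    (hf : ExpConvexOnOrthant fun x : Fin N → ℝ => esymmEval 2 x ^ (-α)) :
    ∀ᶠ h : ℝ in 𝓝[>] 0, 0 ≤ probeForm N κ
      (fun A s => ((1 + h * A) ^ 2 - h ^ 2 * (s / (N * (N - 1)))) ^ (-α)) := by
  have hN' : (2 : ℝ) ≤ N := by exact_mod_cast hN
  have hpos : ∀ᶠ h : ℝ in 𝓝[>] 0, ∀ (i : Option (Bool × Option (Fin N))) l,
      0 < 1 / 2 + h * probeRadial i + h * probeSpatial i l := by
    rw [eventually_all]; intro i
    rw [eventually_all]; intro l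
    have hc : Continuous fun h : ℝ => 1 / 2 + h * probeRadial i + h * probeSpatial i l := by
      fun_prop
    refine ((hc.tendsto 0).mono_left nhdsWithin_le_nhds).eventually_const_lt ?_
    norm_num
  have hpos' : ∀ᶠ h : ℝ in 𝓝[>] 0, ∀ i j : Option (Bool × Option (Fin N)),
      0 < (1 + h * (probeRadial i + probeRadial j)) ^ 2 - h ^ 2 *
        ((∑ l, (probeSpatial i l + probeSpatial j l) ^ 2) / (N * (N - 1))) := by
    rw [eventually_all]; intro i
    rw [eventually_all]; intro j
    have hc : Continuous fun h : ℝ => (1 + h * (probeRadial i + probeRadial j)) ^ 2 - h ^ 2 *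
        ((∑ l, (probeSpatial i l + probeSpatial j l) ^ 2) / (N * (N - 1))) := by
      fun_prop
    refine ((hc.tendsto 0).mono_left nhdsWithin_le_nhds).eventually_const_lt ?_
    norm_num
  filter_upwards [hpos, hpos'] with h hh hh'
  have key := hf _ (probeWeight N κ)
    (fun i l => 1 / 2 + h * probeRadial i + h * probeSpatial i l) hh
  have hc : 0 < (N : ℝ) * (N - 1) / 2 := by
    have : 0 < (N : ℝ) - 1 := by linarith
    positivity
  have hterm : ∀ i j : Option (Bool × Option (Fin N)), esymmEval 2
      ((fun l => 1 / 2 + h * probeRadial i + h * probeSpatial i l) +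
        (fun l => 1 / 2 + h * probeRadial j + h * probeSpatial j l)) ^ (-α) =
      ((N : ℝ) * (N - 1) / 2) ^ (-α) *
        ((1 + h * (probeRadial i + probeRadial j)) ^ 2 - h ^ 2 *
        ((∑ l, (probeSpatial i l + probeSpatial j l) ^ 2) / (N * (N - 1)))) ^ (-α) := by
    intro i j
    rw [← Real.mul_rpow hc.le (hh' i j).le, ← esymmEval_two_lorentz hN]
    · congr 2
      ext l
      simp only [Pi.add_apply]
      ring
    · rw [Finset.sum_add_distrib, sum_probeSpatial (by omega), sum_probeSpatial (by omega),
        add_zero]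
  simp only [hterm] at key
  rw [← sum_probe_eq_probeForm (by omega)]
  refine nonneg_of_mul_nonneg_right ?_ (Real.rpow_pos_of_pos hc (-α))
  convert! key using 1
  simp only [Finset.mul_sum]
  refine Finset.sum_congr rfl fun i _ => Finset.sum_congr rfl fun j _ => ?_
  ring

lemma isBigO_probeForm_sub (M κ : ℝ) {Φ Ψ : ℝ → ℝ → ℝ → ℝ} {r : ℝ → ℝ}
    (h : ∀ A s, (fun h => Φ h A s - Ψ h A s) =O[𝓝 0] r) :
    (fun h => probeForm M κ (Φ h) - probeForm M κ (Ψ h)) =O[𝓝 0] r := by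
  have key : ∀ t, probeForm M κ (Φ t) - probeForm M κ (Ψ t) =
      probeForm M κ (fun A s => Φ t A s - Ψ t A s) := by
    intro t
    simp only [probeForm]
    ring
  simp only [key]
  unfold probeForm
  have hm : ∀ (c : ℝ) {g : ℝ → ℝ}, g =O[𝓝 0] r → (fun t => c * g t) =O[𝓝 0] r :=
    fun c _ hg => hg.const_mul_left c
  refine (((((hm _ (h _ _)).add (hm _ ((h _ _).add (h _ _)))).add
    (hm _ (((h _ _).add (hm _ (h _ _))).add (h _ _)))).sub (hm _ (h _ _))).sub
    (hm _ ((h _ _).add (h _ _)))).add (hm _ ((hm _ ((h _ _).add (h _ _))).add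
      (hm _ ((h _ _).add (h _ _)))))

lemma nonneg_of_eventually_nonneg_of_isBigO {F : ℝ → ℝ} {S : ℝ} {n : ℕ}
    (hF : ∀ᶠ h in 𝓝[>] 0, 0 ≤ F h)
    (hO : (fun h => F h - S * h ^ n) =O[𝓝 0] fun h => h ^ (n + 1)) : 0 ≤ S := by
  have ho : (fun h : ℝ => F h - S * h ^ n) =o[𝓝[>] 0] fun h => h ^ n :=
    (hO.trans_isLittleO (isLittleO_pow_pow (Nat.lt_succ_self n))).mono nhdsWithin_le_nhds
  have ht := ho.tendsto_div_nhds_zero.add_const S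
  rw [zero_add] at ht
  refine ge_of_tendsto ht ?_
  filter_upwards [hF, self_mem_nhdsWithin] with h hh h0
  have h0' : 0 < h := h0
  have : (F h - S * h ^ n) / h ^ n + S = F h / h ^ n := by field_simp; ring
  rw [this]
  positivity

theorem ExpConvexOnOrthant.le_of_esymmEval_two (hN : 2 ≤ N) {α : ℝ} (hα : 0 < α)
    (hf : ExpConvexOnOrthant fun x : Fin N → ℝ => esymmEval 2 x ^ (-α)) :
    ((N : ℝ) - 2) / 2 ≤ α := by
  have hN' : (2 : ℝ) ≤ N := by exact_mod_cast hN
  set κ : ℝ := 1 / (N * (2 * α + 1)) with hκ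
  set S : ℝ := 8 * α * (α + 1) * (2 * α + 2 - N) / ((2 * α + 1) * (N ^ 2 * (N - 1))) with hS
  have h1 : (0 : ℝ) < N := by linarith
  have h2 : (0 : ℝ) < (N : ℝ) - 1 := by linarith
  have hTaylor : ∀ h, probeForm N κ (fun A s => lorentzTaylor α A (s / (N * (N - 1))) h) =
      S * h ^ 4 := by
    intro h
    simp only [probeForm, lorentzTaylor, hκ, hS]
    field_simp
    ring
  have hO := isBigO_probeForm_sub (N : ℝ) κ (r := fun h => h ^ 5)
    (Φ := fun h A s => ((1 + h * A) ^ 2 - h ^ 2 * (s / (N * (N - 1)))) ^ (-α))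
    (Ψ := fun h A s => lorentzTaylor α A (s / (N * (N - 1))) h)
    (fun A s => lorentz_rpow_sub_taylor_isBigO α A (s / (N * (N - 1))))
  simp only [hTaylor] at hO
  have hS0 := nonneg_of_eventually_nonneg_of_isBigO (n := 4) (hf.probeForm_nonneg hN κ) hO
  by_contra! hlt
  refine absurd hS0 (not_le.2 ?_)
  rw [hS]
  refine div_neg_of_neg_of_pos (mul_neg_of_pos_of_neg (by positivity) (by linarith))
    (by positivity)

end Lorentz

/-- For integers `2 ≤ m < n` and real `α ≥ 0`: if `E_{m,n}^{−α}` is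
completely monotone on the positive orthant, then `α = 0` or `α ≥ (n−m)/2`. -/
theorem statement18 (n m : ℕ) (hm2 : 2 ≤ m) (hmn : m < n) (α : ℝ) (hα : 0 ≤ α)
    (hcm : CompletelyMonotoneOn
      (fun x : Fin n → ℝ =>
        (∑ S ∈ Finset.powersetCard m (Finset.univ : Finset (Fin n)), ∏ i ∈ S, x i) ^ (-α))
      {x : Fin n → ℝ | ∀ i, 0 < x i}) :
    α = 0 ∨ ((n : ℝ) - m) / 2 ≤ α := by
  rcases hα.eq_or_lt with rfl | hα
  · exact Or.inl rfl
  right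
  obtain ⟨j, rfl⟩ := Nat.exists_eq_add_of_le hm2
  obtain ⟨N, rfl⟩ := Nat.exists_eq_add_of_le' (show j ≤ n by omega)
  have h := ExpConvexOnOrthant.le_of_esymmEval_two (by omega) hα
    (ExpConvexOnOrthant.esymmEval_two_of_add (by omega) j hcm.expConvexOnOrthant)
  push_cast
  linarith
end
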